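/- Let f be a non wandering positive twist map of the closed annulus A = 𝕋 × [0,1] and let U ⊆ A be an f-invariant lower annulus. Then there exists a continuous function ψ : 𝕋 → (0,1] such that U = {(x,y) ∈ A : 0 ≤ y < ψ(x)}; in particular U is regular and its frontier meets each vertical segment {x}×[0,1], x ∈ 𝕋, in exactly one point. -/

import Mathlib

open Set Filter Topology MeasureTheory

noncomputable section

/-- The circle `𝕋 = ℝ/ℤ`. -/
abbrev 𝕋 : Type := AddCircle (1 : ℝ)

/-- The closed annulus `A = 𝕋 × [0,1]`. -/
abbrev Ann : Type := 𝕋 × ↥(Set.Icc (0:ℝ) 1)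

/-- The universal cover `Ã = ℝ × [0,1]`. -/
abbrev StripA : Type := ℝ × ↥(Set.Icc (0:ℝ) 1)

/-- The covering projection `π : Ã → A`. -/
def annProj : StripA → Ann := fun z => ((z.1 : 𝕋), z.2)

/-- The deck translation `T(x̃,y) = (x̃+1,y)`. -/
def deckT : StripA → StripA := fun z => (z.1 + 1, z.2)

/-- The iterated deck translation `T^p`, `p ∈ ℤ`. -/
def deckZ (p : ℤ) : StripA → StripA := fun z => (z.1 + (p : ℝ), z.2)

/-- The boundary circle `C₀ = 𝕋 × {0}`. -/
def C0 : Set Ann := {z | (z.2 : ℝ) = 0}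

/-- The boundary circle `C₁ = 𝕋 × {1}`. -/
def C1 : Set Ann := {z | (z.2 : ℝ) = 1}

/-- A point of `Ã` on the boundary line `ℝ × {0}`. -/
def bd0 (x : ℝ) : StripA := (x, ⟨0, by norm_num⟩)

/-- A point of `Ã` on the boundary line `ℝ × {1}`. -/
def bd1 (x : ℝ) : StripA := (x, ⟨1, by norm_num⟩)

/-- A homeomorphism of the closed annulus isotopic to the identity, together with a
chosen lift to the universal cover.  (A homeomorphism of `A` is isotopic to the identity
iff it admits a lift commuting with the deck translation and preserving each boundary
line of the strip.) -/
structure AnnulusHomeo where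
  toFun : Ann ≃ₜ Ann
  lift : StripA ≃ₜ StripA
  lift_proj : ∀ z : StripA, annProj (lift z) = toFun (annProj z)
  lift_deck : ∀ z : StripA, lift (deckT z) = deckT (lift z)
  lift_bd0 : ∀ z : StripA, (z.2 : ℝ) = 0 → ((lift z).2 : ℝ) = 0

/-- The iterate `f^k`, `k ∈ ℤ`. -/
def AnnulusHomeo.iter (h : AnnulusHomeo) (k : ℤ) : Ann → Ann :=
  fun z => ((h.toFun.toEquiv : Equiv.Perm Ann) ^ k) z

/-- The iterate `f̃^k` of the lift, `k ∈ ℤ`. -/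
def AnnulusHomeo.liftIter (h : AnnulusHomeo) (k : ℤ) : StripA → StripA :=
  fun z => ((h.lift.toEquiv : Equiv.Perm StripA) ^ k) z

/-- `f` is non wandering: every nonempty open set meets one of its forward iterates. -/
def NonWandering (h : AnnulusHomeo) : Prop :=
  ∀ U : Set Ann, IsOpen U → U.Nonempty → ∃ k : ℕ, 0 < k ∧ (h.iter k '' U ∩ U).Nonempty

/-- The closed strip `ℝ × [0,1]` inside the plane. -/
def stripS : Set (ℝ × ℝ) := {p | p.2 ∈ Set.Icc (0:ℝ) 1}

/-- A positive twist map: a `C¹` diffeomorphism of the annulus, isotopic to the identity,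
whose lift `F` to the strip (together with its inverse `G`) is continuously differentiable
and satisfies `∂(p̃₁ ∘ f̃)/∂y > 0`, i.e. the first component of `DF(z)·(0,1)` is positive. -/
structure PositiveTwistMap extends AnnulusHomeo where
  F : ℝ × ℝ → ℝ × ℝ
  F' : ℝ × ℝ → (ℝ × ℝ) →L[ℝ] (ℝ × ℝ)
  G : ℝ × ℝ → ℝ × ℝ
  G' : ℝ × ℝ → (ℝ × ℝ) →L[ℝ] (ℝ × ℝ)
  F_lift : ∀ z : StripA, F (z.1, (z.2 : ℝ)) = ((lift z).1, ((lift z).2 : ℝ))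
  G_lift : ∀ z : StripA, G (z.1, (z.2 : ℝ)) = ((lift.symm z).1, ((lift.symm z).2 : ℝ))
  F_hasDeriv : ∀ z ∈ stripS, HasFDerivWithinAt F (F' z) stripS z
  G_hasDeriv : ∀ z ∈ stripS, HasFDerivWithinAt G (G' z) stripS z
  F'_cont : ContinuousOn F' stripS
  G'_cont : ContinuousOn G' stripS
  twist_pos : ∀ z ∈ stripS, 0 < (F' z (0, 1)).1

/-- The oriented angle (in `(-π, π]`) from the vertical vector `(0,1)` to the vector `w`. -/
def angleFromVertical (w : ℝ × ℝ) : ℝ := Complex.arg ⟨w.2, -w.1⟩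

/-- `ρ` is the rotation number of `f` on the boundary circle `C₀`, computed with the lift. -/
def HasRotNum0 (h : AnnulusHomeo) (ρ : ℝ) : Prop :=
  ∀ x : ℝ, Tendsto (fun n : ℕ => ((h.liftIter (n : ℤ) (bd0 x)).1 - x) / (n : ℝ))
    atTop (𝓝 ρ)

/-- `ρ` is the rotation number of `f` on the boundary circle `C₁`, computed with the lift. -/
def HasRotNum1 (h : AnnulusHomeo) (ρ : ℝ) : Prop :=
  ∀ x : ℝ, Tendsto (fun n : ℕ => ((h.liftIter (n : ℤ) (bd1 x)).1 - x) / (n : ℝ))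
    atTop (𝓝 ρ)

/-- A closed `f`-invariant set `X ⊆ A` is well ordered if the first projection is injective
on `X` and the lift preserves the horizontal order on `π⁻¹(X)`. -/
def IsWellOrdered (h : AnnulusHomeo) (X : Set Ann) : Prop :=
  IsClosed X ∧ h.toFun '' X = X ∧
  Set.InjOn (fun z : Ann => z.1) X ∧
  ∀ z₁ z₂ : StripA, annProj z₁ ∈ X → annProj z₂ ∈ X → z₁.1 < z₂.1 →
    (h.lift z₁).1 < (h.lift z₂).1

/-- An essential simple loop in the annulus: the range of an injective continuous map
from the circle that is not null-homotopic. -/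
def IsEssentialSimpleLoop (Γ : Set Ann) : Prop :=
  ∃ γ : C(𝕋, Ann), Function.Injective γ ∧ ¬ γ.Nullhomotopic ∧ Set.range γ = Γ

/-- `Γ` meets each vertical segment `{x} × [0,1]` in exactly one point. -/
def MeetsVerticalsOnce (Γ : Set Ann) : Prop :=
  ∀ x : 𝕋, ∃! z : Ann, z ∈ Γ ∧ z.1 = x

/-- No essential simple loop meeting each vertical segment exactly once is invariant,
except the two boundary circles. -/
def NoInvariantTransverseLoop (h : AnnulusHomeo) : Prop :=
  ∀ Γ : Set Ann, IsEssentialSimpleLoop Γ → MeetsVerticalsOnce Γ →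
    h.toFun '' Γ = Γ → Γ = C0 ∨ Γ = C1

/-- A continuum: a nonempty compact connected set. -/
def IsContinuum (X : Set Ann) : Prop := X.Nonempty ∧ IsCompact X ∧ IsPreconnected X

/-- A lower annulus: an open set homeomorphic to `𝕋 × [0,1)` containing `C₀`. -/
def IsLowerAnnulus (U : Set Ann) : Prop :=
  IsOpen U ∧ Nonempty (↥U ≃ₜ (𝕋 × ↥(Set.Ico (0:ℝ) 1))) ∧ C0 ⊆ U

/-- A lower disk: an open set homeomorphic to `ℝ × [0,1)` meeting `C₀`. -/
def IsLowerDisk (U : Set Ann) : Prop :=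
  IsOpen U ∧ Nonempty (↥U ≃ₜ (ℝ × ↥(Set.Ico (0:ℝ) 1))) ∧ (U ∩ C0).Nonempty

/-- A lower annulus is regular if it is a connected component of the complement of an
essential simple loop. -/
def IsRegularLowerAnnulus (U : Set Ann) : Prop :=
  ∃ Γ : Set Ann, IsEssentialSimpleLoop Γ ∧ ∃ z : Ann, U = connectedComponentIn Γᶜ z

/-- A lower disk is regular if it is a connected component of the complement of a simple
arc joining two points of `C₀` and meeting `C₀` only at its endpoints, or of the
complement of an essential simple loop meeting `C₀` in exactly one point. -/
def IsRegularLowerDisk (U : Set Ann) : Prop :=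
  (∃ a : C(↥(Set.Icc (0:ℝ) 1), Ann), Function.Injective a ∧
      (∀ t : ↥(Set.Icc (0:ℝ) 1), a t ∈ C0 ↔ ((t : ℝ) = 0 ∨ (t : ℝ) = 1)) ∧
      ∃ z : Ann, U = connectedComponentIn (Set.range a)ᶜ z) ∨
  (∃ Γ : Set Ann, IsEssentialSimpleLoop Γ ∧ (∃! z : Ann, z ∈ Γ ∩ C0) ∧
      ∃ z : Ann, U = connectedComponentIn Γᶜ z)

end

/-- The lift of a positive twist map moves the upper point of a vertical pair further right. -/
lemma PositiveTwistMap.lift_fst_lt (f : PositiveTwistMap) {z p : StripA} (h : z.1 = p.1)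
    (hlt : (z.2 : ℝ) < p.2) : (f.lift z).1 < (f.lift p).1 := by
  have key : StrictMonoOn (fun y : ℝ => (f.F (z.1, y)).1) (Icc 0 1) := by
    have hd : ∀ y ∈ Icc (0:ℝ) 1, HasDerivWithinAt (fun y : ℝ => (f.F (z.1, y)).1)
        ((f.F' (z.1, y) (0, 1)).1) (Icc 0 1) y := by
      intro y hy
      have h1 := f.F_hasDeriv (z.1, y) hy
      have h2 : HasDerivWithinAt (fun y : ℝ => ((z.1, y) : ℝ × ℝ)) (0, 1) (Icc 0 1) y :=
        ((hasDerivAt_const y z.1).prodMk (hasDerivAt_id y)).hasDerivWithinAt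
      have h3 := h1.comp_hasDerivWithinAt y h2 (fun t ht => ht)
      exact (hasFDerivAt_fst (p := f.F (z.1, y))).comp_hasDerivWithinAt y h3
    refine strictMonoOn_of_hasDerivWithinAt_pos (convex_Icc _ _)
      (fun y hy => (hd y hy).continuousWithinAt)
      (fun y hy => (hd y (interior_subset hy)).mono interior_subset)
      (fun y hy => f.twist_pos _ (interior_subset (s := Icc (0:ℝ) 1) hy))
  have := key z.2.2 p.2.2 hlt
  simp only [f.F_lift z] at this
  rw [h, f.F_lift p] at this
  exact this

lemma isPreconnected_stripS : IsPreconnected stripS := by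
  have : stripS = univ ×ˢ Icc (0:ℝ) 1 := by ext; simp [stripS]
  rw [this]; exact isPreconnected_univ.prod isPreconnected_Icc

lemma uniqueDiffOn_stripS : UniqueDiffOn ℝ stripS := by
  have : stripS = univ ×ˢ Icc (0:ℝ) 1 := by ext; simp [stripS]
  rw [this]; exact uniqueDiffOn_univ.prod (uniqueDiffOn_Icc zero_lt_one)

lemma PositiveTwistMap.F_G (f : PositiveTwistMap) {w : ℝ × ℝ} (hw : w ∈ stripS) :
    f.F (f.G w) = w ∧ f.G w ∈ stripS ∧ f.G (f.F w) = w ∧ f.F w ∈ stripS := by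
  obtain ⟨x, y⟩ := w
  have h1 := f.G_lift (x, ⟨y, hw⟩)
  have h2 := f.F_lift (x, ⟨y, hw⟩)
  have h3 := f.F_lift (f.lift.symm (x, ⟨y, hw⟩))
  have h4 := f.G_lift (f.lift (x, ⟨y, hw⟩))
  simp only [Homeomorph.apply_symm_apply, Homeomorph.symm_apply_apply] at h1 h2 h3 h4
  rw [h1, h2]
  exact ⟨h3, (f.lift.symm (x, ⟨y, hw⟩)).2.2, h4, (f.lift (x, ⟨y, hw⟩)).2.2⟩

lemma PositiveTwistMap.F'_G' (f : PositiveTwistMap) {z : ℝ × ℝ} (hz : z ∈ stripS) (v : ℝ × ℝ) :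
    f.F' (f.G z) (f.G' z v) = v := by
  have h1 := (f.F_hasDeriv (f.G z) (f.F_G hz).2.1).comp z (f.G_hasDeriv z hz)
    (fun w hw => (f.F_G hw).2.1)
  have h2 : HasFDerivWithinAt (f.F ∘ f.G) (ContinuousLinearMap.id ℝ (ℝ × ℝ)) stripS z :=
    (hasFDerivWithinAt_id z stripS).congr (fun w hw => (f.F_G hw).1) (f.F_G hz).1
  have h3 := (uniqueDiffOn_stripS z hz).eq h1 h2
  exact DFunLike.congr_fun h3 v

/-- The lift is increasing along the lower boundary line. -/
lemma AnnulusHomeo.strictMono_bd0 (h : AnnulusHomeo) :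
    StrictMono (fun x : ℝ => (h.lift (bd0 x)).1) := by
  have hb : ∀ x, ((h.lift (bd0 x)).2 : ℝ) = 0 := fun x => h.lift_bd0 _ rfl
  have hc : Continuous (fun x : ℝ => (h.lift (bd0 x)).1) :=
    continuous_fst.comp (h.lift.continuous.comp (by unfold bd0; fun_prop))
  have hinj : Function.Injective (fun x : ℝ => (h.lift (bd0 x)).1) := by
    intro x y hxy
    have : h.lift (bd0 x) = h.lift (bd0 y) :=
      Prod.ext hxy (Subtype.ext ((hb x).trans (hb y).symm))
    exact congrArg Prod.fst (h.lift.injective this)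
  rcases hc.strictMono_of_inj hinj with h1 | h1
  · exact h1
  · have h2 := h1 (zero_lt_one : (0:ℝ) < 1)
    have h3 : h.lift (bd0 1) = deckT (h.lift (bd0 0)) := by
      rw [← h.lift_deck]; simp [deckT, bd0]
    simp only [h3, deckT] at h2
    linarith

/-- The second column of the derivative of the inverse points to the left. -/
lemma PositiveTwistMap.G'_fst_neg (f : PositiveTwistMap) {z : ℝ × ℝ} (hz : z ∈ stripS) :
    (f.G' z (0, 1)).1 < 0 := by
  have hsplit : ∀ (L : (ℝ × ℝ) →L[ℝ] (ℝ × ℝ)) (u v : ℝ),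
      L (u, v) = u • L (1, 0) + v • L (0, 1) := by
    intro L u v
    rw [← map_smul, ← map_smul, ← map_add]; simp
  have hne : ∀ w ∈ stripS, (f.G' w (0, 1)).1 ≠ 0 := by
    intro w hw h0
    have h1 := f.F'_G' hw (0, 1)
    have h2 := f.twist_pos _ (f.F_G hw).2.1
    have h3 : f.G' w (0, 1) = (0, (f.G' w (0, 1)).2) := Prod.ext h0 rfl
    rw [h3, hsplit] at h1
    have h4 := congrArg Prod.fst h1
    have h5 := congrArg Prod.snd h1
    simp at h4 h5
    rcases h4 with h4 | h4
    · rw [h4] at h5; simp at h5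
    · exact h2.ne' h4
  have hcont : ContinuousOn (fun w => (f.G' w (0, 1)).1) stripS :=
    continuous_fst.comp_continuousOn (f.G'_cont.clm_apply continuousOn_const)
  have h00 : ((0:ℝ), (0:ℝ)) ∈ stripS := by simp [stripS]
  have hF0 := (f.F_G h00).2.2.2
  have hbase : (f.G' (f.F (0, 0)) (0, 1)).1 < 0 := by
    have h1 := f.F'_G' hF0 (0, 1)
    rw [(f.F_G h00).2.2.1] at h1
    have hb := f.twist_pos _ h00
    have hDx : HasDerivAt (fun x : ℝ => f.F (x, 0)) (f.F' (0, 0) (1, 0)) 0 := by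
      have h2 : HasDerivWithinAt (fun x : ℝ => ((x, 0) : ℝ × ℝ)) (1, 0) univ 0 :=
        ((hasDerivAt_id (0:ℝ)).prodMk (hasDerivAt_const (0:ℝ) (0:ℝ))).hasDerivWithinAt
      have h3 := HasFDerivWithinAt.comp_hasDerivWithinAt (f := fun x : ℝ => ((x, 0) : ℝ × ℝ)) (0:ℝ)
        (f.F_hasDeriv _ h00) h2 (fun t _ => by simp [stripS])
      simpa [Function.comp_def] using h3
    have hFx : ∀ x : ℝ, f.F (x, 0) = ((f.lift (bd0 x)).1, 0) := by
      intro x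
      have := f.F_lift (bd0 x)
      rw [f.lift_bd0 (bd0 x) rfl] at this
      exact this
    have ha : 0 ≤ (f.F' (0, 0) (1, 0)).1 := by
      have h2 := (hasFDerivAt_fst (p := f.F ((0:ℝ), (0:ℝ)))).comp_hasDerivAt (0:ℝ) hDx
      have h3 : (Prod.fst ∘ fun x : ℝ => f.F (x, 0)) = fun x => (f.lift (bd0 x)).1 := by
        ext x; simp [hFx]
      rw [h3] at h2
      have := h2.deriv ▸ f.toAnnulusHomeo.strictMono_bd0.monotone.deriv_nonneg (x := 0)
      exact this
    have hc : (f.F' (0, 0) (1, 0)).2 = 0 := by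
      have h2 := (hasFDerivAt_snd (p := f.F ((0:ℝ), (0:ℝ)))).comp_hasDerivAt (0:ℝ) hDx
      have h3 : (Prod.snd ∘ fun x : ℝ => f.F (x, 0)) = fun x => 0 := by
        ext x; simp [hFx]
      rw [h3] at h2
      exact h2.unique (hasDerivAt_const _ _)
    have hd : 0 ≤ (f.F' (0, 0) (0, 1)).2 := by
      have h2 : HasDerivWithinAt (fun y : ℝ => (((0:ℝ), y) : ℝ × ℝ)) (0, 1) (Icc 0 1) 0 :=
        ((hasDerivAt_const (0:ℝ) (0:ℝ)).prodMk (hasDerivAt_id (0:ℝ))).hasDerivWithinAt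
      have h3 := (f.F_hasDeriv _ h00).comp_hasDerivWithinAt (0:ℝ) h2 (fun t ht => ht)
      have h4 := (hasFDerivAt_snd (p := f.F ((0:ℝ), (0:ℝ)))).comp_hasDerivWithinAt (0:ℝ) h3
      have h5 := h4.mono Ioc_subset_Icc_self
      rw [hasDerivWithinAt_iff_tendsto_slope' (by simp)] at h5
      have : (𝓝[Ioc (0:ℝ) 1] 0).NeBot := by
        rw [← mem_closure_iff_nhdsWithin_neBot, closure_Ioc zero_ne_one]; simp
      refine ge_of_tendsto h5 ?_
      filter_upwards [self_mem_nhdsWithin] with y hy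
      rw [slope_def_field]
      have e0 : (f.F ((0:ℝ), (0:ℝ))).2 = 0 := by rw [hFx]
      have e1 := (f.F_G (w := ((0:ℝ), y)) ⟨hy.1.le, hy.2⟩).2.2.2.1
      simp only [Function.comp, e0, sub_zero]
      exact div_nonneg e1 hy.1.le
    set u := f.G' (f.F (0, 0)) (0, 1) with hu
    rw [← Prod.mk.eta (p := u), hsplit] at h1
    have h4 := congrArg Prod.fst h1
    have h5 := congrArg Prod.snd h1
    simp [hc] at h4 h5
    have hv : 0 < u.2 := by
      by_contra hv
      nlinarith
    have hu0 : u.1 * (f.F' (0, 0) (1, 0)).1 < 0 := by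
      have : 0 < u.2 * (f.F' (0, 0) (0, 1)).1 := mul_pos hv hb
      linarith
    by_contra hcon
    exact absurd hu0 (not_lt.2 (mul_nonneg (not_lt.1 hcon) ha))
  by_contra hcon
  have himg := isPreconnected_stripS.image _ hcont
  have := himg.ordConnected.out (mem_image_of_mem _ hF0) (mem_image_of_mem _ hz)
    ⟨hbase.le, not_lt.1 hcon⟩
  obtain ⟨w, hw, hw0⟩ := this
  exact hne w hw hw0

/-- The inverse of the lift moves the upper point of a vertical pair further left. -/
lemma PositiveTwistMap.lift_symm_fst_lt (f : PositiveTwistMap) {z p : StripA} (h : z.1 = p.1)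
    (hlt : (z.2 : ℝ) < p.2) : (f.lift.symm p).1 < (f.lift.symm z).1 := by
  have key : StrictAntiOn (fun y : ℝ => (f.G (z.1, y)).1) (Icc 0 1) := by
    have hd : ∀ y ∈ Icc (0:ℝ) 1, HasDerivWithinAt (fun y : ℝ => (f.G (z.1, y)).1)
        ((f.G' (z.1, y) (0, 1)).1) (Icc 0 1) y := by
      intro y hy
      have h1 := f.G_hasDeriv (z.1, y) hy
      have h2 : HasDerivWithinAt (fun y : ℝ => ((z.1, y) : ℝ × ℝ)) (0, 1) (Icc 0 1) y :=
        ((hasDerivAt_const y z.1).prodMk (hasDerivAt_id y)).hasDerivWithinAt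
      have h3 := h1.comp_hasDerivWithinAt y h2 (fun t ht => ht)
      exact (hasFDerivAt_fst (p := f.G (z.1, y))).comp_hasDerivWithinAt y h3
    refine strictAntiOn_of_hasDerivWithinAt_neg (convex_Icc _ _)
      (fun y hy => (hd y hy).continuousWithinAt)
      (fun y hy => (hd y (interior_subset hy)).mono interior_subset)
      (fun y hy => f.G'_fst_neg (interior_subset (s := Icc (0:ℝ) 1) hy))
  have := key z.2.2 p.2.2 hlt
  simp only [f.G_lift z] at this
  rw [h, f.G_lift p] at this
  exact this

/-- `t` is a determination of the angle, counted counterclockwise from the downward vertical,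
of the vector from `p` to `z`. -/
def IsAngle (z p : StripA) (t : ℝ) : Prop :=
  ∃ r : ℝ, 0 < r ∧ z.1 - p.1 = r * Real.sin t ∧ (p.2 : ℝ) - z.2 = r * Real.cos t

/-- A real number that is not an odd multiple of `π` lies in a translate of `(-π, π)`. -/
lemma exists_int_of_not_odd_pi {t : ℝ} (h : ¬ (Real.sin t = 0 ∧ Real.cos t < 0)) :
    ∃ j : ℤ, (-1 + 2 * j) * Real.pi < t ∧ t < (1 + 2 * j) * Real.pi := by
  have hpi := Real.pi_pos
  refine ⟨⌊(t / Real.pi + 1) / 2⌋, ?_, ?_⟩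
  · have h1 := Int.floor_le ((t / Real.pi + 1) / 2)
    set j := ⌊(t / Real.pi + 1) / 2⌋
    have h2 : (-1 + 2 * (j:ℝ)) * Real.pi ≤ t := by
      rw [← le_div_iff₀ hpi]; linarith
    refine lt_of_le_of_ne h2 fun h3 => h ?_
    have h4 : t = -Real.pi + j * (2 * Real.pi) := by rw [← h3]; ring
    rw [h4, Real.sin_add_int_mul_two_pi, Real.cos_add_int_mul_two_pi]
    simp
  · have h1 := Int.lt_floor_add_one ((t / Real.pi + 1) / 2)
    rw [← div_lt_iff₀ hpi]; linarith

lemma exists_int_of_sin_neg {t : ℝ} (h : Real.sin t < 0) :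
    ∃ j : ℤ, (-1 + 2 * j) * Real.pi < t ∧ t < (2 * j) * Real.pi := by
  obtain ⟨j, h1, h2⟩ := exists_int_of_not_odd_pi (t := t) (fun h' => h.ne h'.1)
  refine ⟨j, h1, ?_⟩
  by_contra h3
  have h4 : t - j * (2 * Real.pi) ∈ Icc 0 Real.pi := ⟨by linarith, by linarith⟩
  have h5 := Real.sin_nonneg_of_mem_Icc h4
  rw [Real.sin_sub_int_mul_two_pi] at h5
  linarith

lemma sin_pos_of_mem_int_Ioo {t : ℝ} {k : ℤ} (h1 : k * Real.pi < t) (h2 : t < (k + 1) * Real.pi) :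
    0 < Real.sin (t - k * Real.pi) :=
  Real.sin_pos_of_pos_of_lt_pi (by linarith) (by linarith)

/-- Multiplying by `(-1)^k` turns an angle `t` into `t - kπ`. -/
lemma neg_one_zpow_cases (k : ℤ) (t : ℝ) :
    (Real.sin (t - k * Real.pi) = Real.sin t ∧ Real.cos (t - k * Real.pi) = Real.cos t ∧
      Real.cos (k * Real.pi) = 1) ∨
    (Real.sin (t - k * Real.pi) = -Real.sin t ∧ Real.cos (t - k * Real.pi) = -Real.cos t ∧
      Real.cos (k * Real.pi) = -1) := by
  rw [Real.sin_sub_int_mul_pi, Real.cos_sub_int_mul_pi, Real.cos_int_mul_pi]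
  rcases Int.even_or_odd k with h | h
  · left; simp [h.neg_one_zpow]
  · right; simp [h.neg_one_zpow]

section Twist

variable {X : Type*} [TopologicalSpace X] {φ : StripA → StripA}

/-- Comparison of angles at a pair of points on the same vertical. -/
lemma angle_twist_vertical (h1 : ∀ z p : StripA, z.1 = p.1 → (z.2 : ℝ) < p.2 → (φ z).1 < (φ p).1)
    {z p : StripA} {a b : ℝ} (ha : IsAngle z p a) (hb : IsAngle (φ z) (φ p) b) {k : ℤ}
    (hk : a = k * Real.pi) :
    ∃ j : ℤ, (k - 1 + 2 * j) * Real.pi < b ∧ b < (k + 2 * j) * Real.pi := by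
  obtain ⟨r, hr, hs, hc⟩ := ha
  obtain ⟨r', hr', hs', hc'⟩ := hb
  rw [hk, Real.sin_int_mul_pi, mul_zero, sub_eq_zero] at hs
  rw [hk] at hc
  have hsin : Real.sin (b - k * Real.pi) < 0 := by
    rcases neg_one_zpow_cases k b with ⟨e1, -, e3⟩ | ⟨e1, -, e3⟩
    · rw [e3] at hc
      have := h1 z p hs (by linarith)
      rw [e1]
      by_contra hcon
      have := mul_nonneg hr'.le (not_lt.1 hcon)
      linarith
    · rw [e3] at hc
      have := h1 p z hs.symm (by linarith)
      rw [e1]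
      by_contra hcon
      have := mul_nonneg hr'.le (not_lt.1 hcon)
      linarith
  obtain ⟨j, hj1, hj2⟩ := exists_int_of_sin_neg hsin
  exact ⟨j, by linarith, by linarith⟩

/-- Comparison of angles at a pair of points on different verticals. -/
lemma angle_twist_nonvertical
    (h2 : ∀ z p : StripA, (φ z).1 = (φ p).1 → ((φ z).2 : ℝ) < (φ p).2 → p.1 < z.1)
    {z p : StripA} {a b : ℝ} (ha : IsAngle z p a) (hb : IsAngle (φ z) (φ p) b) {k : ℤ}
    (hk : k * Real.pi < a) (hk' : a < (k + 1) * Real.pi) :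
    ∃ j : ℤ, (k - 1 + 2 * j) * Real.pi < b ∧ b < (k + 1 + 2 * j) * Real.pi := by
  obtain ⟨r, hr, hs, hc⟩ := ha
  obtain ⟨r', hr', hs', hc'⟩ := hb
  have hpos := mul_pos hr (sin_pos_of_mem_int_Ioo hk hk')
  have hne : ¬ (Real.sin (b - k * Real.pi) = 0 ∧ Real.cos (b - k * Real.pi) < 0) := by
    rintro ⟨hb0, hb1⟩
    have hb1' := mul_neg_of_pos_of_neg hr' hb1
    have hp : ((-1 : ℝ) ^ k) = 1 ∨ ((-1 : ℝ) ^ k) = -1 := by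
      rcases Int.even_or_odd k with h | h
      · left; simp [h.neg_one_zpow]
      · right; simp [h.neg_one_zpow]
    rw [Real.sin_sub_int_mul_pi] at hpos hb0
    rw [Real.cos_sub_int_mul_pi] at hb1'
    rcases hp with e | e <;> rw [e] at hpos hb0 hb1'
    · have hb0' : Real.sin b = 0 := by linarith
      rw [hb0'] at hs'
      have := h2 p z (by linarith) (by linarith)
      linarith
    · have hb0' : Real.sin b = 0 := by linarith
      rw [hb0'] at hs'
      have := h2 z p (by linarith) (by linarith)
      linarith
  obtain ⟨j, hj1, hj2⟩ := exists_int_of_not_odd_pi hne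
  exact ⟨j, by linarith, by linarith⟩

/-- Under a twist map, the angle of a moving point seen from a fixed one never crosses a
multiple of `π` upwards. -/
theorem angle_twist_lt [PreconnectedSpace X]
    (h1 : ∀ z p : StripA, z.1 = p.1 → (z.2 : ℝ) < p.2 → (φ z).1 < (φ p).1)
    (h2 : ∀ z p : StripA, (φ z).1 = (φ p).1 → ((φ z).2 : ℝ) < (φ p).2 → p.1 < z.1)
    {ι : X → StripA} {p : StripA} {a b : X → ℝ} (hac : Continuous a) (hbc : Continuous b)
    (ha : ∀ x, IsAngle (ι x) p (a x)) (hb : ∀ x, IsAngle (φ (ι x)) (φ p) (b x))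
    {x₀ : X} (ha₀ : a x₀ = 0) (hb₀ : -Real.pi < b x₀) (hb₀' : b x₀ < 0)
    {x : X} {m : ℤ} (hx : a x ≤ m * Real.pi) : b x < m * Real.pi := by
  have hpi := Real.pi_pos
  let k : X → ℤ := fun x => ⌊a x / Real.pi⌋
  let J : X → ℤ := fun x => ⌊(b x / Real.pi - k x + 1) / 2⌋
  have hJ : ∀ (x : X) (l j : ℤ), k x = l → (l - 1 + 2 * j) * Real.pi ≤ b x →
      b x < (l + 1 + 2 * j) * Real.pi → J x = j := by
    intro x l j hl e1 e2
    rw [← le_div_iff₀ hpi] at e1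
    rw [← div_lt_iff₀ hpi] at e2
    simp only [J, hl, Int.floor_eq_iff]
    constructor <;> linarith
  have hk : ∀ (x : X) (l : ℤ), l * Real.pi ≤ a x → a x < (l + 1) * Real.pi → k x = l := by
    intro x l e1 e2
    rw [← le_div_iff₀ hpi] at e1
    rw [← div_lt_iff₀ hpi] at e2
    simp only [k, Int.floor_eq_iff]
    exact ⟨e1, e2⟩
  have hkx : ∀ x, (k x) * Real.pi ≤ a x ∧ a x < (k x + 1) * Real.pi := by
    intro x
    rw [← le_div_iff₀ hpi, ← div_lt_iff₀ hpi]
    exact ⟨Int.floor_le _, Int.lt_floor_add_one _⟩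
  have hloc : IsLocallyConstant J := by
    rw [IsLocallyConstant.iff_eventually_eq]
    intro x
    obtain ⟨e1, e2⟩ := hkx x
    rcases e1.eq_or_lt with e1 | e1
    · obtain ⟨j, f1, f2⟩ := angle_twist_vertical h1 (ha x) (hb x) e1.symm
      rw [hJ x _ j rfl f1.le (by linarith)]
      filter_upwards [hac.continuousAt.eventually (eventually_lt_nhds e2),
        hac.continuousAt.eventually (eventually_gt_nhds
          (show (k x - 1) * Real.pi < a x by linarith)),
        hbc.continuousAt.eventually (eventually_lt_nhds f2),
        hbc.continuousAt.eventually (eventually_gt_nhds f1)] with y g1 g2 g3 g4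
      by_cases g : k x * Real.pi ≤ a y
      · exact hJ y _ j (hk y _ g g1) g4.le (by linarith)
      · refine hJ y _ j (hk y (k x - 1) ?_ ?_) ?_ ?_ <;> push_cast <;> linarith
    · obtain ⟨j, f1, f2⟩ := angle_twist_nonvertical h2 (ha x) (hb x) e1 e2
      rw [hJ x _ j rfl f1.le f2]
      filter_upwards [hac.continuousAt.eventually (eventually_lt_nhds e2),
        hac.continuousAt.eventually (eventually_gt_nhds e1),
        hbc.continuousAt.eventually (eventually_lt_nhds f2),
        hbc.continuousAt.eventually (eventually_gt_nhds f1)] with y g1 g2 g3 g4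
      exact hJ y _ j (hk y _ g2.le g1) g4.le g3
  have hJ0 : J x₀ = 0 :=
    hJ x₀ 0 0 (hk x₀ 0 (by simp [ha₀]) (by simp [ha₀, hpi])) (by push_cast; linarith)
      (by push_cast; linarith)
  have hJx : J x = 0 := by rw [← hJ0]; exact hloc.apply_eq_of_preconnectedSpace x x₀
  obtain ⟨e1, e2⟩ := hkx x
  rcases e1.eq_or_lt with e1 | e1
  · obtain ⟨j, f1, f2⟩ := angle_twist_vertical h1 (ha x) (hb x) e1.symm
    have hj := hJ x _ j rfl f1.le (by linarith)
    rw [hJx] at hj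
    rw [← hj] at f2
    push_cast at f2
    linarith
  · obtain ⟨j, f1, f2⟩ := angle_twist_nonvertical h2 (ha x) (hb x) e1 e2
    have hj := hJ x _ j rfl f1.le f2
    rw [hJx] at hj
    rw [← hj] at f2
    push_cast at f2
    have : (k x : ℝ) < m := lt_of_mul_lt_mul_right (e1.trans_le hx) hpi.le
    have h3 : (k x : ℝ) + 1 ≤ m := by exact_mod_cast Int.add_one_le_of_lt (by exact_mod_cast this)
    calc b x < (k x + 1 + 2 * 0) * Real.pi := f2
      _ ≤ m * Real.pi := by
        apply mul_le_mul_of_nonneg_right _ hpi.le; linarith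

end Twist

section Lift

open unitInterval

/-- Lifting through a covering map over a product with a contractible factor. -/
lemma IsCoveringMap.exists_lift_of_contraction {E X Y Z : Type*} [TopologicalSpace E]
    [TopologicalSpace X] [TopologicalSpace Y] [TopologicalSpace Z] {p : E → X}
    (cov : IsCoveringMap p) (c : C(I × Y, Y)) {y₀ : Y} (hc0 : ∀ y, c (0, y) = y₀)
    (hc1 : ∀ y, c (1, y) = y) (hcy : ∀ t, c (t, y₀) = y₀) (g : C(Y × Z, X)) (e : C(Z, E))
    (he : ∀ z, p (e z) = g (y₀, z)) :
    ∃ θ : C(Y × Z, E), (∀ w, p (θ w) = g w) ∧ ∀ z, θ (y₀, z) = e z := by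
  let H : C(I × (Y × Z), X) := ⟨fun w => g (c (w.1, w.2.1), w.2.2), by fun_prop⟩
  let f : C(Y × Z, E) := ⟨fun w => e w.2, by fun_prop⟩
  have h0 : ∀ w, H (0, w) = p (f w) := fun w => by simp [H, f, hc0, he]
  let L := cov.liftHomotopy H f h0
  have hL : ∀ w, p (L w) = H w := fun w => congr_fun (cov.liftHomotopy_lifts H f h0) w
  have hL0 : ∀ w, L (0, w) = f w := cov.liftHomotopy_zero H f h0
  refine ⟨⟨fun w => L (1, w), by fun_prop⟩, fun w => by simp [hL, H, hc1], fun z => ?_⟩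
  have hconst : (fun t : I => L (t, (y₀, z))) = fun _ => e z := by
    refine cov.eq_of_comp_eq (by fun_prop) continuous_const ?_ 0 (hL0 _)
    ext t
    simp [hL, H, hcy, he]
  exact congr_fun hconst 1

end Lift

/-- The half-open strip, universal cover of the half-open annulus. -/
abbrev HalfStrip : Type := ℝ × ↥(Set.Ico (0:ℝ) 1)

instance : PreconnectedSpace HalfStrip :=
  have : PreconnectedSpace ↥(Set.Ico (0:ℝ) 1) := Subtype.preconnectedSpace isPreconnected_Ico
  inferInstance

open unitInterval in
/-- The straight-line contraction of the half-open strip to one of its points. -/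
def halfStripContraction (w₀ : HalfStrip) : C(I × HalfStrip, HalfStrip) where
  toFun u := ((1 - (u.1 : ℝ)) * w₀.1 + u.1 * u.2.1,
    ⟨(1 - (u.1 : ℝ)) * w₀.2 + u.1 * u.2.2,
      (convex_Ico (0:ℝ) 1) w₀.2.2 u.2.2.2 (by linarith [u.1.2.2]) u.1.2.1 (by ring)⟩)
  continuous_toFun := by fun_prop

lemma halfStripContraction_zero (w₀ w : HalfStrip) : halfStripContraction w₀ (0, w) = w₀ := by
  simp [halfStripContraction]

lemma halfStripContraction_one (w₀ w : HalfStrip) : halfStripContraction w₀ (1, w) = w := by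
  simp [halfStripContraction]

open unitInterval in
lemma halfStripContraction_base (w₀ : HalfStrip) (t : I) :
    halfStripContraction w₀ (t, w₀) = w₀ := by
  refine Prod.ext ?_ (Subtype.ext ?_) <;> simp [halfStripContraction] <;> ring

lemma coe_circle_eq_iff {a b : ℝ} : (a : 𝕋) = b ↔ ∃ n : ℤ, b = a + n := by
  rw [eq_comm, ← sub_eq_zero, ← AddCircle.coe_sub, AddCircle.coe_eq_zero_iff]
  constructor
  · rintro ⟨n, hn⟩; exact ⟨n, by simp at hn; linarith⟩
  · rintro ⟨n, hn⟩; exact ⟨n, by simp; linarith⟩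

/-- The projection of the half-open strip to the half-open annulus. -/
def halfProj (w : HalfStrip) : 𝕋 × ↥(Set.Ico (0:ℝ) 1) := ((w.1 : 𝕋), w.2)

lemma continuous_coe_circle : Continuous ((↑) : ℝ → 𝕋) := AddCircle.continuous_mk' 1

lemma HalfStrip.apply_add_int {q : HalfStrip → ℝ} {d : ℤ}
    (hd : ∀ w : HalfStrip, q (w.1 + 1, w.2) = q w + d) (n : ℤ) (w : HalfStrip) :
    q (w.1 + n, w.2) = q w + n * d := by
  induction n using Int.induction_on with
  | zero => simp
  | succ n ih =>
    have := hd (w.1 + n, w.2)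
    simp only at this
    rw [show w.1 + ((n : ℤ) + 1 : ℤ) = w.1 + n + 1 by push_cast; ring, this]
    push_cast at ih ⊢
    rw [ih]; ring
  | pred n ih =>
    have h1 := hd (w.1 + (-(n:ℝ) - 1), w.2)
    push_cast at ih ⊢
    simp only at h1
    rw [show w.1 + (-(n:ℝ) - 1) + 1 = w.1 + -n by ring, ih] at h1
    linarith

/-- The parametrization of a lower annulus wraps around the annulus exactly once. -/
lemma IsLowerAnnulus.exists_lift {U : Set Ann} (hC : C0 ⊆ U)
    (h : ↥U ≃ₜ (𝕋 × ↥(Set.Ico (0:ℝ) 1))) :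
    ∃ q : HalfStrip → ℝ, Continuous q ∧ (∀ w, (q w : 𝕋) = (h.symm (halfProj w)).1.1) ∧
      ∃ d : ℤ, (d = 1 ∨ d = -1) ∧ ∀ w : HalfStrip, q (w.1 + 1, w.2) = q w + d := by
  have cov : IsCoveringMap ((↑) : ℝ → 𝕋) := AddCircle.isCoveringMap_coe 1
  have hproj : Continuous halfProj :=
    (continuous_coe_circle.comp continuous_fst).prodMk continuous_snd
  have lift : ∀ g : C(HalfStrip, 𝕋), ∃ q : HalfStrip → ℝ, Continuous q ∧ ∀ w, (q w : 𝕋) = g w := by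
    intro g
    let w₀ : HalfStrip := (0, ⟨0, by norm_num⟩)
    obtain ⟨r, hr⟩ := QuotientAddGroup.mk_surjective (g w₀)
    obtain ⟨θ, h1, -⟩ := cov.exists_lift_of_contraction (Z := Unit) (halfStripContraction w₀)
      (halfStripContraction_zero w₀) (halfStripContraction_one w₀)
      (halfStripContraction_base w₀) ⟨fun w => g w.1, by fun_prop⟩ ⟨fun _ => r, by fun_prop⟩
      (fun _ => hr)
    exact ⟨fun w => θ (w, ()), by fun_prop, fun w => h1 _⟩
  have per : ∀ (q : HalfStrip → ℝ), Continuous q → (∀ w : HalfStrip, (q (w.1 + 1, w.2) : 𝕋) = q w) →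
      ∃ d : ℤ, ∀ w : HalfStrip, q (w.1 + 1, w.2) = q w + d := by
    intro q hq hper
    let w₀ : HalfStrip := (0, ⟨0, by norm_num⟩)
    obtain ⟨d, hd⟩ := coe_circle_eq_iff.1 (hper w₀).symm
    refine ⟨d, fun w => congr_fun (cov.eq_of_comp_eq (g₁ := fun w : HalfStrip => q (w.1 + 1, w.2))
      (g₂ := fun w => q w + d) (by fun_prop) (by fun_prop) ?_ w₀ hd) w⟩
    ext w
    exact (hper w).trans (coe_circle_eq_iff.2 ⟨d, rfl⟩)
  obtain ⟨q, hqc, hq⟩ := lift ⟨fun w => (h.symm (halfProj w)).1.1, by fun_prop⟩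
  simp only [ContinuousMap.coe_mk] at hq
  have hper1 : ∀ w : HalfStrip, halfProj (w.1 + 1, w.2) = halfProj w := by
    intro w
    refine Prod.ext ?_ rfl
    exact (coe_circle_eq_iff.2 ⟨1, by simp⟩).symm
  obtain ⟨d, hd⟩ := per q hqc (fun w => by rw [hq, hq, hper1])
  refine ⟨q, hqc, hq, d, ?_, hd⟩
  have hdn := HalfStrip.apply_add_int hd
  -- the lift of the boundary circle in the coordinates of the parametrization
  have hCmem : ∀ w : HalfStrip, (((w.1 : 𝕋), ⟨0, by norm_num⟩) : Ann) ∈ U := fun w => hC rfl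
  let κ : HalfStrip → 𝕋 × ↥(Set.Ico (0:ℝ) 1) := fun w => h ⟨((w.1 : 𝕋), ⟨0, by norm_num⟩), hCmem w⟩
  have hκ : Continuous κ := h.continuous.comp (Continuous.subtype_mk
    ((continuous_coe_circle.comp continuous_fst).prodMk continuous_const) _)
  have hκp : ∀ w : HalfStrip, κ (w.1 + 1, w.2) = κ w := by
    intro w
    have : ((w.1 + 1 : ℝ) : 𝕋) = (w.1 : 𝕋) := (coe_circle_eq_iff.2 ⟨1, by simp⟩).symm
    simp only [κ, this]
  obtain ⟨σ, hσc, hσ⟩ := lift ⟨fun w => (κ w).1, by fun_prop⟩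
  simp only [ContinuousMap.coe_mk] at hσ
  obtain ⟨e, he⟩ := per σ hσc (fun w => by rw [hσ, hσ, hκp])
  let w₀ : HalfStrip := (0, ⟨0, by norm_num⟩)
  have hqσ : ∀ w : HalfStrip, (q (σ w, (κ w).2) : 𝕋) = w.1 := by
    intro w
    rw [hq]
    have : halfProj (σ w, (κ w).2) = κ w := Prod.ext (hσ w) rfl
    rw [this]
    simp [κ]
  obtain ⟨n, hn⟩ := coe_circle_eq_iff.1 (hqσ w₀).symm
  have heq : (fun w : HalfStrip => q (σ w, (κ w).2)) = fun w : HalfStrip => w.1 + n := by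
    refine cov.eq_of_comp_eq (by fun_prop) (by fun_prop) ?_ w₀ hn
    ext w
    exact (hqσ w).trans (coe_circle_eq_iff.2 ⟨n, rfl⟩)
  have h1 := congr_fun heq w₀
  have h2 := congr_fun heq (w₀.1 + 1, w₀.2)
  simp only [he, hκp] at h1 h2
  have h3 := hdn e (σ w₀, (κ w₀).2)
  simp only at h3
  have h4 : (e : ℝ) * d = 1 := by linarith
  have h5 : e * d = 1 := by exact_mod_cast h4
  exact Int.eq_one_or_neg_one_of_mul_eq_one (by rw [mul_comm]; exact h5)

lemma IsLocalHomeomorph.prodMap_id {X Y Z : Type*} [TopologicalSpace X] [TopologicalSpace Y]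
    [TopologicalSpace Z] {g : X → Y} (hg : IsLocalHomeomorph g) :
    IsLocalHomeomorph (Prod.map g (id : Z → Z)) := by
  rintro ⟨x, z⟩
  obtain ⟨e, hx, rfl⟩ := hg x
  exact ⟨e.prod (OpenPartialHomeomorph.refl Z), ⟨hx, mem_univ _⟩, rfl⟩

lemma isLocalHomeomorph_annProj : IsLocalHomeomorph annProj :=
  (AddCircle.isLocalHomeomorph_coe (1:ℝ)).prodMap_id

lemma isLocalHomeomorph_halfProj : IsLocalHomeomorph halfProj :=
  (AddCircle.isLocalHomeomorph_coe (1:ℝ)).prodMap_id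

lemma continuous_annProj : Continuous annProj := isLocalHomeomorph_annProj.continuous

lemma annProj_eq_iff {z w : StripA} : annProj z = annProj w ↔ ∃ n : ℤ, w = deckZ n z := by
  constructor
  · intro h
    obtain ⟨n, hn⟩ := coe_circle_eq_iff.1 (congrArg Prod.fst h)
    exact ⟨n, Prod.ext hn (congrArg Prod.snd h).symm⟩
  · rintro ⟨n, rfl⟩
    exact Prod.ext (coe_circle_eq_iff.2 ⟨n, rfl⟩) rfl

lemma annProj_surjective : Function.Surjective annProj := by
  rintro ⟨x, y⟩
  obtain ⟨r, hr⟩ := QuotientAddGroup.mk_surjective x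
  exact ⟨(r, y), Prod.ext hr rfl⟩

lemma halfProj_surjective : Function.Surjective halfProj := by
  rintro ⟨x, y⟩
  obtain ⟨r, hr⟩ := QuotientAddGroup.mk_surjective x
  exact ⟨(r, y), Prod.ext hr rfl⟩

/-- The preimage of a lower annulus in the strip is homeomorphic to a half-open strip. -/
lemma IsLowerAnnulus.nonempty_homeomorph {U : Set Ann} (hU : IsLowerAnnulus U) :
    Nonempty (HalfStrip ≃ₜ ↥(annProj ⁻¹' U)) := by
  obtain ⟨hUo, ⟨h⟩, hC⟩ := hU
  obtain ⟨q, hqc, hq, d, hd, hqd⟩ := IsLowerAnnulus.exists_lift hC h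
  let G : HalfStrip → StripA := fun w => (q w, (h.symm (halfProj w)).1.2)
  have hGp : annProj ∘ G = Subtype.val ∘ h.symm ∘ halfProj := by
    ext1 w
    exact Prod.ext (hq w) rfl
  have hloc : IsLocalHomeomorph (annProj ∘ G) := by
    rw [hGp]
    exact hUo.isOpenEmbedding_subtypeVal.isLocalHomeomorph.comp
      (h.symm.isLocalHomeomorph.comp isLocalHomeomorph_halfProj)
  have hGc : Continuous G := by
    have := isLocalHomeomorph_halfProj.continuous
    fun_prop
  have hGloc : IsLocalHomeomorph G := hloc.of_comp isLocalHomeomorph_annProj hGc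
  have hdn := HalfStrip.apply_add_int hqd
  have hd0 : (d : ℝ) ≠ 0 := by rcases hd with rfl | rfl <;> norm_num
  have hd2 : d * d = 1 := by rcases hd with rfl | rfl <;> norm_num
  have hGinj : Function.Injective G := by
    intro w w' hww
    have h1 : halfProj w = halfProj w' := by
      have := congr_arg annProj hww
      have h2 := congr_fun hGp
      simp only [Function.comp] at h2
      rw [h2, h2] at this
      exact h.symm.injective (Subtype.ext this)
    obtain ⟨n, hn⟩ := coe_circle_eq_iff.1 (congrArg Prod.fst h1)
    have h2 : w' = (w.1 + n, w.2) := Prod.ext hn (congrArg Prod.snd h1).symm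
    have h3 : q w = q w' := congrArg Prod.fst hww
    rw [h2, hdn] at h3
    have h4 : (n : ℝ) * d = 0 := by linarith
    rcases mul_eq_zero.1 h4 with h5 | h5
    · rw [h2, h5, add_zero]
    · exact absurd h5 hd0
  have hGrange : range G = annProj ⁻¹' U := by
    ext z
    constructor
    · rintro ⟨w, rfl⟩
      have := congr_fun hGp w
      simp only [Function.comp] at this
      rw [mem_preimage, this]
      exact Subtype.coe_prop _
    · intro hz
      obtain ⟨w, hw⟩ := halfProj_surjective (h ⟨annProj z, hz⟩)
      have h1 : annProj (G w) = annProj z := by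
        have := congr_fun hGp w
        simp only [Function.comp] at this
        rw [this, hw, h.symm_apply_apply]
      obtain ⟨n, hn⟩ := annProj_eq_iff.1 h1
      refine ⟨(w.1 + (n * d : ℤ), w.2), ?_⟩
      rw [hn]
      refine Prod.ext ?_ ?_
      · simp only [G, deckZ]
        rw [hdn]
        have : (d : ℝ) * d = 1 := by exact_mod_cast hd2
        push_cast
        linear_combination (n:ℝ) * this
      · have : halfProj (w.1 + (n * d : ℤ), w.2) = halfProj w :=
          Prod.ext (coe_circle_eq_iff.2 ⟨n * d, rfl⟩).symm rfl
        simp only [G, deckZ, this]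
  exact ⟨(hGloc.isOpenEmbedding_of_injective hGinj).isEmbedding.toHomeomorph.trans
    (Homeomorph.setCongr hGrange)⟩

/-- A lower annulus contains no full vertical segment. -/
lemma IsLowerAnnulus.exists_notMem_vertical {U : Set Ann} (hU : IsLowerAnnulus U) (x : 𝕋) :
    ∃ y, (x, y) ∉ U := by
  by_contra! hcon
  obtain ⟨-, ⟨h⟩, hC⟩ := hU
  obtain ⟨q, hqc, hq, d, hd, hqd⟩ := IsLowerAnnulus.exists_lift hC h
  let t : ↥(Icc (0:ℝ) 1) → ℝ := fun y => (h ⟨(x, y), hcon y⟩).2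
  have ht : Continuous t := by fun_prop
  obtain ⟨y₀, -, hy₀⟩ := isCompact_univ.exists_isMaxOn (univ_nonempty) ht.continuousOn
  have ht1 : t y₀ < 1 := (h ⟨(x, y₀), hcon y₀⟩).2.2.2
  have ht0 : 0 ≤ t y₀ := (h ⟨(x, y₀), hcon y₀⟩).2.2.1
  let s : ↥(Ico (0:ℝ) 1) := ⟨(t y₀ + 1) / 2, by constructor <;> linarith⟩
  obtain ⟨r, hr⟩ := QuotientAddGroup.mk_surjective x
  have hne : ∀ (u : ℝ) (n : ℤ), q (u, s) ≠ r + n := by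
    intro u n hu
    have h1 : (q (u, s) : 𝕋) = x := by
      rw [← hr]; exact (coe_circle_eq_iff.2 ⟨n, hu⟩).symm
    rw [hq] at h1
    set w := h.symm (halfProj (u, s)) with hw
    have h2 : w = ⟨(x, w.1.2), hcon _⟩ := Subtype.ext (Prod.ext h1 rfl)
    have h3 : t w.1.2 = s := by
      simp only [t]
      rw [← h2, hw, h.apply_symm_apply]
      rfl
    have h4 : t w.1.2 ≤ t y₀ := hy₀ (mem_univ _)
    rw [h3] at h4
    have : (s : ℝ) = (t y₀ + 1) / 2 := rfl
    linarith
  have hqs : Continuous fun u : ℝ => q (u, s) := by fun_prop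
  have h1 := hqd (0, s)
  simp only [zero_add] at h1
  obtain ⟨n, hn1, hn2⟩ : ∃ n : ℤ, min (q (0, s)) (q (1, s)) ≤ r + n ∧
      r + n ≤ max (q (0, s)) (q (1, s)) := by
    refine ⟨⌊max (q (0, s)) (q (1, s)) - r⌋, ?_, ?_⟩
    · have := Int.lt_floor_add_one (max (q (0, s)) (q (1, s)) - r)
      have h2 : min (q (0, s)) (q (1, s)) = max (q (0, s)) (q (1, s)) - 1 := by
        rw [h1]
        rcases hd with rfl | rfl
        · push_cast; rw [min_eq_left (by linarith), max_eq_right (by linarith)]; ring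
        · push_cast; rw [min_eq_right (by linarith), max_eq_left (by linarith)]; ring
      linarith
    · have := Int.floor_le (max (q (0, s)) (q (1, s)) - r)
      linarith
  obtain ⟨u, -, hu⟩ := intermediate_value_uIcc (a := 0) (b := 1) hqs.continuousOn
    (show r + n ∈ uIcc (q (0, s)) (q (1, s)) from ⟨hn1, hn2⟩)
  exact hne u n hu

/-- The vector from `z` to `p`, rotated so that its argument is the angle in `IsAngle`. -/
def stripVec (z p : StripA) : ℂ := ⟨p.2 - z.2, z.1 - p.1⟩

lemma stripVec_ne_zero {z p : StripA} (h : z ≠ p) : stripVec z p ≠ 0 := by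
  contrapose! h
  have h1 := congrArg Complex.re h
  have h2 := congrArg Complex.im h
  simp only [stripVec, Complex.zero_re, Complex.zero_im] at h1 h2
  exact Prod.ext (by linarith) (Subtype.ext (by linarith))

lemma continuous_stripVec : Continuous fun w : StripA × StripA => stripVec w.1 w.2 := by
  have : (fun w : StripA × StripA => stripVec w.1 w.2) = fun w =>
      (((w.2.2 : ℝ) - w.1.2 : ℝ) : ℂ) + ((w.1.1 - w.2.1 : ℝ) : ℂ) * Complex.I := by
    ext w
    apply Complex.ext <;> simp [stripVec]
  rw [this]
  fun_prop

lemma stripVec_deckZ (n : ℤ) (z p : StripA) :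
    stripVec (deckZ n z) (deckZ n p) = stripVec z p := by
  simp [stripVec, deckZ]

lemma isAngle_of_exp_eq {z p : StripA} (h : z ≠ p) {t : ℝ}
    (ht : (Circle.exp t : ℂ) = stripVec z p / (‖stripVec z p‖ : ℂ)) : IsAngle z p t := by
  have hr : 0 < ‖stripVec z p‖ := norm_pos_iff.2 (stripVec_ne_zero h)
  have hr' : (‖stripVec z p‖ : ℂ) ≠ 0 := by exact_mod_cast hr.ne'
  rw [eq_div_iff hr', Circle.coe_exp] at ht
  refine ⟨‖stripVec z p‖, hr, ?_, ?_⟩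
  · have := congrArg Complex.im ht
    rw [Complex.im_mul_ofReal, Complex.exp_ofReal_mul_I_im] at this
    rw [mul_comm, this]; rfl
  · have := congrArg Complex.re ht
    rw [Complex.re_mul_ofReal, Complex.exp_ofReal_mul_I_re] at this
    rw [mul_comm, this]; rfl

lemma exp_arg_stripVec {z p : StripA} (h : z ≠ p) :
    (Circle.exp (stripVec z p).arg : ℂ) = stripVec z p / (‖stripVec z p‖ : ℂ) := by
  have hr : (‖stripVec z p‖ : ℂ) ≠ 0 := by
    exact_mod_cast (norm_pos_iff.2 (stripVec_ne_zero h)).ne'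
  rw [eq_div_iff hr, Circle.coe_exp, mul_comm, Complex.norm_mul_exp_arg_mul_I]

section Angle

variable {U : Set Ann}

lemma ne_of_mem_notMem {z p : StripA} (hz : annProj z ∈ U) (hp : annProj p ∈ Uᶜ) : z ≠ p := by
  rintro rfl
  exact hp hz

lemma annProj_mem_of_bottom (hC : C0 ⊆ U) {z : StripA} (hz : (z.2 : ℝ) = 0) : annProj z ∈ U :=
  hC hz

lemma pos_of_notMem (hC : C0 ⊆ U) {p : StripA} (hp : annProj p ∈ Uᶜ) : 0 < (p.2 : ℝ) :=
  lt_of_le_of_ne p.2.2.1 fun h => hp (hC h.symm)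

lemma stripVec_mem_slitPlane (hC : C0 ⊆ U) {z p : StripA} (hz : (z.2 : ℝ) = 0)
    (hp : annProj p ∈ Uᶜ) : stripVec z p ∈ Complex.slitPlane := by
  left
  have := pos_of_notMem hC hp
  simp [stripVec, hz, this]

lemma continuous_bd0 : Continuous bd0 := by unfold bd0; fun_prop

/-- A continuous determination of the angle under which points outside a lower annulus are seen
from points inside it. -/
lemma IsLowerAnnulus.exists_angle (hU : IsLowerAnnulus U) :
    ∃ θ : C(↥(annProj ⁻¹' U) × ↥(annProj ⁻¹' Uᶜ), ℝ), (∀ z p, IsAngle z.1 p.1 (θ (z, p))) ∧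
      (∀ z p, (z.1.2 : ℝ) = 0 → θ (z, p) = (stripVec z.1 p.1).arg) ∧
      ∀ (n : ℤ) (z z' p p'), z'.1 = deckZ n z.1 → p'.1 = deckZ n p.1 →
        θ (z', p') = θ (z, p) := by
  obtain ⟨Φ⟩ := hU.nonempty_homeomorph
  have hC := hU.2.2
  let W := ↥(annProj ⁻¹' U)
  let K := ↥(annProj ⁻¹' Uᶜ)
  have : PreconnectedSpace W :=
    Φ.surjective.denseRange.preconnectedSpace Φ.continuous
  let bot : ℝ → W := fun s => ⟨bd0 s, annProj_mem_of_bottom hC rfl⟩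
  have hbot : Continuous bot := continuous_bd0.subtype_mk _
  have hne : ∀ w : W × K, stripVec w.1.1 w.2.1 ≠ 0 := fun w =>
    stripVec_ne_zero (ne_of_mem_notMem w.1.2 w.2.2)
  have hsc : Continuous fun w : W × K => stripVec w.1.1 w.2.1 :=
    continuous_stripVec.comp 
      ((continuous_subtype_val.comp continuous_fst).prodMk
        (continuous_subtype_val.comp continuous_snd))
  let dir : C(W × K, Circle) := ⟨fun w =>
      ⟨stripVec w.1.1 w.2.1 / (‖stripVec w.1.1 w.2.1‖ : ℂ), by
        have h := norm_pos_iff.2 (hne w)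
        simp [Submonoid.unitSphere, h.ne']⟩, by
    refine Continuous.subtype_mk (hsc.div (Complex.continuous_ofReal.comp hsc.norm) ?_) _
    intro w
    exact Complex.ofReal_ne_zero.2 (norm_pos_iff.2 (hne w)).ne'⟩
  have hdirarg : ∀ w : W × K, Circle.exp (stripVec w.1.1 w.2.1).arg = dir w := fun w =>
    Circle.ext (exp_arg_stripVec (ne_of_mem_notMem w.1.2 w.2.2))
  have hargc : ∀ {Z : Type} [TopologicalSpace Z] (i : Z → W × K), Continuous i →
      (∀ x, ((i x).1.1.2 : ℝ) = 0) →
      Continuous fun x => (stripVec (i x).1.1 (i x).2.1).arg := by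
    intro Z _ i hi h0
    rw [continuous_iff_continuousAt]
    intro x
    exact ContinuousAt.comp (f := fun x => stripVec (i x).1.1 (i x).2.1)
      (Complex.continuousAt_arg (stripVec_mem_slitPlane hC (h0 x) (i x).2.2))
      (hsc.comp hi).continuousAt
  let w₀ := Φ.symm (bot 0)
  obtain ⟨θ', hθ'1, hθ'2⟩ := Circle.isCoveringMap_exp.exists_lift_of_contraction
    (halfStripContraction w₀)
    (y₀ := w₀) (halfStripContraction_zero w₀) (halfStripContraction_one w₀)
    (halfStripContraction_base w₀)
    (⟨fun u => dir (Φ u.1, u.2), by fun_prop⟩ : C(HalfStrip × K, Circle))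
    (⟨fun p => (stripVec (bot 0).1 p.1).arg,
      hargc (fun p => (bot 0, p)) (by fun_prop) (fun _ => rfl)⟩ : C(K, ℝ))
    (fun p => by
      simp only [ContinuousMap.coe_mk, w₀, Φ.apply_symm_apply]
      exact hdirarg (bot 0, p))
  let θ : C(W × K, ℝ) := ⟨fun w => θ' (Φ.symm w.1, w.2), by fun_prop⟩
  have hexp : ∀ w, Circle.exp (θ w) = dir w := by
    intro w
    have := hθ'1 (Φ.symm w.1, w.2)
    simpa [θ] using this
  have h0 : ∀ p, θ (bot 0, p) = (stripVec (bot 0).1 p.1).arg := fun p => hθ'2 p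
  have hb : ∀ s p, θ (bot s, p) = (stripVec (bot s).1 p.1).arg := by
    intro s p
    refine congr_fun (Circle.isCoveringMap_exp.eq_of_comp_eq
      (g₁ := fun s => θ (bot s, p)) (g₂ := fun s => (stripVec (bot s).1 p.1).arg) (by fun_prop)
      (hargc (fun s => (bot s, p)) (by fun_prop) (fun _ => rfl)) ?_ 0 (h0 p)) s
    ext1 s
    simp only [Function.comp]
    rw [hexp, hdirarg (bot s, p)]
  have hbz : ∀ z p, (z.1.2 : ℝ) = 0 → θ (z, p) = (stripVec z.1 p.1).arg := by
    intro z p hz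
    have : z = bot z.1.1 := Subtype.ext (Prod.ext rfl (Subtype.ext hz))
    rw [this]
    exact hb _ p
  refine ⟨θ, fun z p => isAngle_of_exp_eq (ne_of_mem_notMem z.2 p.2) ?_, hbz, ?_⟩
  · rw [hexp]
    rfl
  · intro n z z' p p' hz hp
    have hTm : ∀ z : W, deckZ n z.1 ∈ annProj ⁻¹' U := fun z => by
      rw [mem_preimage, ← annProj_eq_iff.2 ⟨n, rfl⟩]
      exact z.2
    let T : W → W := fun z => ⟨deckZ n z.1, hTm z⟩
    have hT : Continuous T := by
      refine Continuous.subtype_mk ?_ _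
      unfold deckZ
      fun_prop
    have hTz : z' = T z := Subtype.ext hz
    rw [hTz]
    refine congr_fun (Circle.isCoveringMap_exp.eq_of_comp_eq
      (g₁ := fun z => θ (T z, p')) (g₂ := fun z => θ (z, p)) (by fun_prop) (by fun_prop)
      ?_ (bot 0) ?_) z
    · ext1 z
      simp only [Function.comp]
      rw [hexp, hexp, ← hdirarg, ← hdirarg]
      simp only [T, hp, stripVec_deckZ]
    · rw [hbz (T (bot 0)) p' rfl, hbz (bot 0) p rfl]
      simp only [T, hp, stripVec_deckZ]

end Angle

/-- A nonwandering homeomorphism has no proper trapping region inside an invariant connected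
set. -/
lemma eq_empty_of_image_subset_of_nonwandering {X : Type*} [TopologicalSpace X] (φ : X ≃ₜ X)
    (hnw : ∀ O : Set X, IsOpen O → O.Nonempty → ∃ k : ℕ, 0 < k ∧ (φ^[k] '' O ∩ O).Nonempty)
    {U S S' : Set X} (hφU : φ '' U = U) (hU : IsPreconnected U) (hS' : IsOpen S')
    (hS'S : S' ⊆ S) (hSU : S ⊆ U) (hS : closure S ∩ U ⊆ S) (hφ : φ '' S ⊆ S')
    (hne : ¬ U ⊆ S') : S = ∅ := by
  have hcl : closure (φ '' S) ∩ U ⊆ φ '' S := by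
    rw [← φ.image_closure]
    nth_rw 1 [← hφU]
    rw [← image_inter φ.injective]
    exact image_mono hS
  have hO : S' \ closure (φ '' S) = ∅ := by
    by_contra hne
    obtain ⟨k, hk, _, ⟨x, hx, rfl⟩, hx2⟩ :=
      hnw _ (hS'.sdiff isClosed_closure) (nonempty_iff_ne_empty.2 hne)
    have hit : ∀ n : ℕ, φ^[n] x ∈ S := by
      intro n
      induction n with
      | zero => exact hS'S hx.1
      | succ n ih =>
        rw [Function.iterate_succ_apply']
        exact hS'S (hφ (mem_image_of_mem _ ih))
    obtain ⟨n, rfl⟩ := Nat.exists_eq_add_one.2 hk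
    rw [Function.iterate_succ_apply'] at hx2
    exact hx2.2 (subset_closure (mem_image_of_mem _ (hit n)))
  rw [sdiff_eq_empty] at hO
  by_contra hSne
  obtain ⟨x, hx⟩ := nonempty_iff_ne_empty.2 hSne
  refine hne (hU.subset_of_closure_inter_subset hS'
    ⟨φ x, hSU (hS'S (hφ (mem_image_of_mem _ hx))), hφ (mem_image_of_mem _ hx)⟩ ?_)
  rintro y ⟨hy, hyU⟩
  exact hφ (hcl ⟨closure_minimal hO isClosed_closure hy, hyU⟩)

lemma NonWandering.exists_iterate {h : AnnulusHomeo} (hnw : NonWandering h) (O : Set Ann)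
    (hO : IsOpen O) (hne : O.Nonempty) : ∃ k : ℕ, 0 < k ∧ (h.toFun^[k] '' O ∩ O).Nonempty := by
  obtain ⟨k, hk, hk'⟩ := hnw O hO hne
  refine ⟨k, hk, ?_⟩
  have : h.iter (k : ℤ) = h.toFun^[k] := by
    ext1 z
    simp only [AnnulusHomeo.iter, zpow_natCast]
    rw [← Equiv.Perm.iterate_eq_pow]
    rfl
  rwa [this] at hk'

lemma NonWandering.exists_iterate_symm {h : AnnulusHomeo} (hnw : NonWandering h) (O : Set Ann)
    (hO : IsOpen O) (hne : O.Nonempty) :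
    ∃ k : ℕ, 0 < k ∧ (h.toFun.symm^[k] '' O ∩ O).Nonempty := by
  obtain ⟨k, hk, _, ⟨x, hx, rfl⟩, hx'⟩ := hnw.exists_iterate O hO hne
  exact ⟨k, hk, x, ⟨_, hx', (Function.LeftInverse.iterate h.toFun.symm_apply_apply k) x⟩, hx⟩

section Trap

variable {U : Set Ann}

/-- If `g` is less than `π` on the bottom and equals `π` only along verticals, then being less
than `π` uniformly in the second variable is an open condition. -/
lemma IsLowerAnnulus.eventually_forall_lt_pi (hU : IsLowerAnnulus U)
    (g : C(↥(annProj ⁻¹' U) × ↥(annProj ⁻¹' Uᶜ), ℝ))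
    (hg0 : ∀ z p, (z.1.2 : ℝ) = 0 → g (z, p) < Real.pi)
    (hgv : ∀ z p, g (z, p) = Real.pi → z.1.1 = p.1.1) {z₀ : ↥(annProj ⁻¹' U)}
    (hz₀ : ∀ p, g (z₀, p) < Real.pi) : ∀ᶠ z in 𝓝 z₀, ∀ p, g (z, p) < Real.pi := by
  obtain ⟨Φ⟩ := hU.nonempty_homeomorph
  let b : ↥(annProj ⁻¹' U) := ⟨bd0 0, annProj_mem_of_bottom hU.2.2 rfl⟩
  set w₀ := Φ.symm z₀ with hw₀
  set wb := Φ.symm b with hwb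
  obtain ⟨M, hM1⟩ := exists_gt (max |w₀.1| |wb.1|)
  obtain ⟨c, hc1, hc2⟩ := exists_between (max_lt w₀.2.2.2 wb.2.2.2)
  have hMw : ∀ w : HalfStrip, |w.1| < M → (w.2 : ℝ) < c →
      ∃ u : ↥(Icc (-M) M) × ↥(Icc 0 c), (u.1 : ℝ) = w.1 ∧ (u.2 : ℝ) = w.2 := fun w h1 h2 =>
    ⟨(⟨w.1, (abs_lt.1 h1).1.le, (abs_lt.1 h1).2.le⟩, ⟨w.2, w.2.2.1, h2.le⟩), rfl, rfl⟩
  let κ : ↥(Icc (-M) M) × ↥(Icc 0 c) → ↥(annProj ⁻¹' U) := fun u =>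
    Φ (u.1, ⟨u.2, u.2.2.1, u.2.2.2.trans_lt hc2⟩)
  have hκ : Continuous κ := by fun_prop
  have hκr : ∀ w : HalfStrip, |w.1| < M → (w.2 : ℝ) < c → Φ w ∈ range κ := by
    intro w h1 h2
    obtain ⟨u, hu1, hu2⟩ := hMw w h1 h2
    exact ⟨u, congrArg Φ (Prod.ext hu1 (Subtype.ext hu2))⟩
  have : PreconnectedSpace ↥(Icc (-M) M) := Subtype.preconnectedSpace isPreconnected_Icc
  have : PreconnectedSpace ↥(Icc 0 c) := Subtype.preconnectedSpace isPreconnected_Icc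
  have hpre : IsPreconnected (range κ) := isPreconnected_range hκ
  have hbr : b ∈ range κ := by
    rw [← Φ.apply_symm_apply b]
    exact hκr _ ((le_max_right _ _).trans_lt hM1) ((le_max_right _ _).trans_lt hc1)
  have hnhds : range κ ∈ 𝓝 z₀ := by
    have h1 : ∀ᶠ w in 𝓝 w₀, |w.1| < M ∧ (w.2 : ℝ) < c := by
      refine ((by fun_prop : Continuous fun w : HalfStrip => |w.1|).continuousAt.eventually_lt
        continuousAt_const ((le_max_left _ _).trans_lt hM1)).and
        ((by fun_prop : Continuous fun w : HalfStrip => (w.2 : ℝ)).continuousAt.eventually_lt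
        continuousAt_const ((le_max_left _ _).trans_lt hc1))
    filter_upwards [Φ.symm.continuous.continuousAt.eventually h1] with z hz
    rw [← Φ.apply_symm_apply z]
    exact hκr _ hz.1 hz.2
  obtain ⟨B, hB⟩ := ((isCompact_range hκ).image
    (by fun_prop : Continuous fun z : ↥(annProj ⁻¹' U) => |z.1.1|)).bddAbove
  have hfar : ∀ p : ↥(annProj ⁻¹' Uᶜ), B < |p.1.1| → ∀ z ∈ range κ, g (z, p) < Real.pi := by
    intro p hp z hz
    by_contra! hcon
    obtain ⟨y, hy, hy2⟩ := hpre.intermediate_value hbr hz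
      (by fun_prop : Continuous fun z => g (z, p)).continuousOn
      ⟨(hg0 b p rfl).le, hcon⟩
    have h1 := hB (mem_image_of_mem _ hy)
    simp only [hgv y p hy2] at h1
    linarith
  have hK : IsClosed (annProj ⁻¹' Uᶜ) := hU.1.isClosed_compl.preimage continuous_annProj
  have hcomp : IsCompact {p : ↥(annProj ⁻¹' Uᶜ) | |p.1.1| ≤ B} := by
    have : IsCompact ((Icc (-B) B) ×ˢ (univ : Set ↥(Icc (0:ℝ) 1))) :=
      isCompact_Icc.prod isCompact_univ
    convert hK.isClosedEmbedding_subtypeVal.isCompact_preimage this using 1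
    ext p
    simp [abs_le]
  have hnear := hcomp.eventually_forall_of_forall_eventually (x₀ := z₀)
    (P := fun z p => g (z, p) < Real.pi) (fun p _ =>
      g.continuous.continuousAt.eventually_lt continuousAt_const (hz₀ p))
  filter_upwards [hnear, hnhds] with z h1 h2 p
  by_cases hp : |p.1.1| ≤ B
  · exact h1 p hp
  · exact hfar p (not_le.1 hp) z h2

lemma IsLowerAnnulus.isPreconnected (hU : IsLowerAnnulus U) : IsPreconnected U := by
  obtain ⟨h⟩ := hU.2.1
  have : PreconnectedSpace ↥(Ico (0:ℝ) 1) := Subtype.preconnectedSpace isPreconnected_Ico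
  have := h.symm.surjective.denseRange.preconnectedSpace h.symm.continuous
  exact isPreconnected_iff_preconnectedSpace.2 this

/-- If the angle condition `π ≤ g` is strictly improved by a nonwandering homeomorphism, then
it never occurs. -/
lemma IsLowerAnnulus.lt_pi_of_nonwandering (hU : IsLowerAnnulus U)
    (g : C(↥(annProj ⁻¹' U) × ↥(annProj ⁻¹' Uᶜ), ℝ))
    (hg0 : ∀ z p, (z.1.2 : ℝ) = 0 → g (z, p) < Real.pi)
    (hgv : ∀ z p, g (z, p) = Real.pi → z.1.1 = p.1.1)
    (hgd : ∀ (n : ℤ) (z z' p p'), z'.1 = deckZ n z.1 → p'.1 = deckZ n p.1 →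
        g (z', p') = g (z, p))
    (φ : Ann ≃ₜ Ann) (hφU : φ '' U = U)
    (hnw : ∀ O : Set Ann, IsOpen O → O.Nonempty → ∃ k : ℕ, 0 < k ∧ (φ^[k] '' O ∩ O).Nonempty)
    (hφ : ∀ z p, Real.pi ≤ g (z, p) →
      ∃ z' p', annProj z'.1 = φ (annProj z.1) ∧ Real.pi < g (z', p')) :
    ∀ z p, g (z, p) < Real.pi := by
  let pr : ↥(annProj ⁻¹' U) → Ann := fun z => annProj z.1
  have hpro : IsOpenMap pr := isLocalHomeomorph_annProj.isOpenMap.comp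
    (hU.1.preimage continuous_annProj).isOpenMap_subtype_val
  let S := {x | ∃ z p, pr z = x ∧ Real.pi ≤ g (z, p)}
  let S' := {x | ∃ z p, pr z = x ∧ Real.pi < g (z, p)}
  have hlift : ∀ z z' : ↥(annProj ⁻¹' U), pr z = pr z' → ∀ p, ∃ p', g (z', p') = g (z, p) := by
    intro z z' h p
    obtain ⟨n, hn⟩ := annProj_eq_iff.1 h
    refine ⟨⟨deckZ n p.1, ?_⟩, hgd n _ _ _ _ hn rfl⟩
    rw [mem_preimage, ← annProj_eq_iff.2 ⟨n, rfl⟩]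
    exact p.2
  have hS' : IsOpen S' := by
    have : S' = ⋃ p, pr '' {z | Real.pi < g (z, p)} := by
      ext x
      simp only [S', mem_ofPred_eq, mem_iUnion, mem_image]
      exact ⟨fun ⟨z, p, h1, h2⟩ => ⟨p, z, h2, h1⟩, fun ⟨p, z, h2, h1⟩ => ⟨z, p, h1, h2⟩⟩
    rw [this]
    exact isOpen_iUnion fun p => hpro _ (isOpen_lt continuous_const (by fun_prop))
  have hS : closure S ∩ U ⊆ S := by
    rintro x ⟨hx, hxU⟩
    by_contra hxS
    obtain ⟨z₀, rfl⟩ := annProj_surjective x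
    have h0 : ∀ p, g (⟨z₀, hxU⟩, p) < Real.pi := by
      intro p
      by_contra! h
      exact hxS ⟨_, p, rfl, h⟩
    have h1 := hpro.image_mem_nhds (hU.eventually_forall_lt_pi g hg0 hgv h0)
    obtain ⟨_, ⟨z, hz, rfl⟩, z', p, h2, h3⟩ := mem_closure_iff_nhds.1 hx _ h1
    obtain ⟨p', hp'⟩ := hlift _ _ h2 p
    have := hz p'
    linarith
  have hbot : ¬ U ⊆ S' := by
    intro h
    obtain ⟨z, p, h1, h2⟩ := h (annProj_mem_of_bottom hU.2.2 (z := bd0 0) rfl)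
    have h3 : (z.1.2 : ℝ) = 0 := congrArg (fun x : Ann => (x.2 : ℝ)) h1
    have := hg0 z p h3
    linarith
  have hempty : S = ∅ := by
    refine eq_empty_of_image_subset_of_nonwandering φ hnw hφU hU.isPreconnected hS' ?_ ?_ hS ?_ hbot
    · rintro x ⟨z, p, h1, h2⟩
      exact ⟨z, p, h1, h2.le⟩
    · rintro x ⟨z, p, rfl, -⟩
      exact z.2
    · rintro _ ⟨_, ⟨z, p, rfl, h2⟩, rfl⟩
      obtain ⟨z', p', h3, h4⟩ := hφ z p h2
      exact ⟨z', p', h3, h4⟩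
  intro z p
  by_contra! h
  exact notMem_empty (pr z) (hempty ▸ ⟨z, p, rfl, h⟩)

end Trap

section Dynamics

variable {U : Set Ann}

lemma AnnulusHomeo.lift_mem_iff (h : AnnulusHomeo) (hUinv : h.toFun '' U = U) {z : StripA} :
    annProj (h.lift z) ∈ U ↔ annProj z ∈ U := by
  rw [h.lift_proj]
  nth_rw 1 [← hUinv]
  exact h.toFun.injective.mem_set_image

lemma AnnulusHomeo.lift_symm_mem_iff (h : AnnulusHomeo) (hUinv : h.toFun '' U = U) {z : StripA} :
    annProj (h.lift.symm z) ∈ U ↔ annProj z ∈ U := by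
  rw [← h.lift_mem_iff hUinv, h.lift.apply_symm_apply]

/-- The angle under which a point outside an invariant lower annulus is seen from a point inside
never crosses a multiple of `π` upwards under the twist map. -/
lemma PositiveTwistMap.angle_lt (f : PositiveTwistMap) (hU : IsLowerAnnulus U)
    {θ : C(↥(annProj ⁻¹' U) × ↥(annProj ⁻¹' Uᶜ), ℝ)}
    (hθ : ∀ z p, IsAngle z.1 p.1 (θ (z, p)))
    (hθ0 : ∀ z p, (z.1.2 : ℝ) = 0 → θ (z, p) = (stripVec z.1 p.1).arg)
    {z z' : ↥(annProj ⁻¹' U)} {p p' : ↥(annProj ⁻¹' Uᶜ)} (hUinv : f.toFun '' U = U)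
    (hz : z'.1 = f.lift z.1) (hp : p'.1 = f.lift p.1) {m : ℤ}
    (h : θ (z, p) ≤ m * Real.pi) : θ (z', p') < m * Real.pi := by
  obtain ⟨Φ⟩ := hU.nonempty_homeomorph
  have : PreconnectedSpace ↥(annProj ⁻¹' U) :=
    Φ.surjective.denseRange.preconnectedSpace Φ.continuous
  let F : ↥(annProj ⁻¹' U) → ↥(annProj ⁻¹' U) := fun z =>
    ⟨f.lift z.1, (f.lift_mem_iff hUinv).2 z.2⟩
  have hF : Continuous F := (f.lift.continuous.comp continuous_subtype_val).subtype_mk _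
  let x₀ : ↥(annProj ⁻¹' U) := ⟨bd0 p.1.1, annProj_mem_of_bottom hU.2.2 rfl⟩
  have hF0 : ((F x₀).1.2 : ℝ) = 0 := f.lift_bd0 _ rfl
  have hppos : 0 < (p.1.2 : ℝ) := pos_of_notMem hU.2.2 p.2
  have hppos' : 0 < (p'.1.2 : ℝ) := pos_of_notMem hU.2.2 p'.2
  have hx0 : (f.lift (bd0 p.1.1)).1 < (f.lift p.1).1 := f.lift_fst_lt rfl hppos
  have key := angle_twist_lt (φ := f.lift) (fun z p h1 h2 => f.lift_fst_lt h1 h2)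
    (fun z p h1 h2 => by simpa using f.lift_symm_fst_lt h1 h2)
    (ι := Subtype.val) (p := p.1) (a := fun z => θ (z, p)) (b := fun z => θ (F z, p'))
    (by fun_prop) (by fun_prop) (fun z => hθ z p)
    (fun z => by rw [← hp]; exact hθ (F z) p') (x₀ := x₀)
    (by
      rw [hθ0 _ _ rfl, Complex.arg_eq_zero_iff]
      refine ⟨?_, ?_⟩ <;> simp [stripVec, x₀, bd0, hppos.le])
    (by
      rw [hθ0 _ _ hF0]
      exact Complex.neg_pi_lt_arg _)
    (by
      rw [hθ0 _ _ hF0, Complex.arg_neg_iff]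
      simpa [stripVec, hp] using hx0)
    h
  rwa [show z' = F z from Subtype.ext hz]

lemma IsAngle.fst_eq {z p : StripA} {t : ℝ} (h : IsAngle z p t) (ht : Real.sin t = 0) :
    z.1 = p.1 := by
  obtain ⟨r, -, h1, -⟩ := h
  rw [ht, mul_zero] at h1
  linarith

/-- An invariant lower annulus of a nonwandering twist map is closed under going down along
verticals. -/
lemma PositiveTwistMap.mem_of_le (f : PositiveTwistMap) (hnw : NonWandering f.toAnnulusHomeo)
    (hU : IsLowerAnnulus U) (hUinv : f.toFun '' U = U) {z p : StripA} (hz : annProj z ∈ U)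
    (h1 : z.1 = p.1) (h2 : p.2 ≤ z.2) : annProj p ∈ U := by
  by_contra hp
  obtain ⟨θ, hθ, hθ0, hθd⟩ := hU.exists_angle
  have hbot : ∀ z p, (z.1.2 : ℝ) = 0 → |θ (z, p)| < Real.pi := by
    intro z p hz
    rw [hθ0 z p hz]
    have := Complex.abs_arg_lt_pi_div_two_iff.2 (.inl (by
      simpa [stripVec, hz] using pos_of_notMem hU.2.2 p.2 : 0 < (stripVec z.1 p.1).re))
    linarith [Real.pi_pos]
  have hsymmU : f.toFun.symm '' U = U := by
    nth_rw 1 [← hUinv]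
    exact f.toFun.symm_image_image U
  have hlt : ∀ z p, θ (z, p) < Real.pi := by
    refine hU.lt_pi_of_nonwandering θ (fun z p hz => (abs_lt.1 (hbot z p hz)).2)
      (fun z p h => (hθ z p).fst_eq (by rw [h, Real.sin_pi])) hθd f.toFun.symm hsymmU
      hnw.exists_iterate_symm ?_
    intro z p h
    let z' : ↥(annProj ⁻¹' U) := ⟨f.lift.symm z.1, (f.lift_symm_mem_iff hUinv).2 z.2⟩
    let p' : ↥(annProj ⁻¹' Uᶜ) := ⟨f.lift.symm p.1, fun h => p.2 ((f.lift_symm_mem_iff hUinv).1 h)⟩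
    refine ⟨z', p', ?_, ?_⟩
    · rw [Homeomorph.eq_symm_apply, ← f.lift_proj]
      simp [z']
    · by_contra! hcon
      have := f.angle_lt hU hθ hθ0 (z := z') (z' := z) (p := p') (p' := p) hUinv
        (by simp [z']) (by simp [p']) (m := 1) (by simpa using hcon)
      simp only [Int.cast_one, one_mul] at this
      linarith
  have hgt : ∀ z p, -θ (z, p) < Real.pi := by
    refine hU.lt_pi_of_nonwandering (-θ) (fun z p hz => neg_lt.1 (abs_lt.1 (hbot z p hz)).1)
      (fun z p h => (hθ z p).fst_eq ?_) (fun n z z' p p' hz hp => congrArg Neg.neg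
        (hθd n z z' p p' hz hp)) f.toFun hUinv hnw.exists_iterate ?_
    · have : θ (z, p) = -Real.pi := by
        rw [← h]; simp
      rw [this, Real.sin_neg, Real.sin_pi, neg_zero]
    intro z p h
    refine ⟨⟨f.lift z.1, (f.lift_mem_iff hUinv).2 z.2⟩,
      ⟨f.lift p.1, fun h => p.2 ((f.lift_mem_iff hUinv).1 h)⟩, f.lift_proj _, ?_⟩
    have h' : Real.pi ≤ -θ (z, p) := h
    have := f.angle_lt hU hθ hθ0 (z := z) (p := p) hUinv
      (z' := ⟨f.lift z.1, (f.lift_mem_iff hUinv).2 z.2⟩)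
      (p' := ⟨f.lift p.1, fun h => p.2 ((f.lift_mem_iff hUinv).1 h)⟩) rfl rfl
      (m := -1) (by push_cast; linarith)
    push_cast at this
    simp only [ContinuousMap.neg_apply]
    linarith
  obtain ⟨r, hr, hs, hc⟩ := hθ ⟨z, hz⟩ ⟨p, hp⟩
  have e1 := hlt ⟨z, hz⟩ ⟨p, hp⟩
  have e2 := hgt ⟨z, hz⟩ ⟨p, hp⟩
  have hs0 : Real.sin (θ (⟨z, hz⟩, ⟨p, hp⟩)) = 0 := by
    have : r * Real.sin (θ (⟨z, hz⟩, ⟨p, hp⟩)) = 0 := by rw [← hs]; simp [h1]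
    exact (mul_eq_zero.1 this).resolve_left hr.ne'
  have ht0 := (Real.sin_eq_zero_iff_of_lt_of_lt (by linarith) e1).1 hs0
  rw [ht0, Real.cos_zero, mul_one] at hc
  have : (p.2 : ℝ) ≤ z.2 := h2
  simp only at hc
  linarith

end Dynamics

section Subgraph

variable {U : Set Ann}

/-- If an invariant set closed under going down misses a point `(x₀, c₁)` but contains a point
`(x, c₂)` with `c₁ < c₂` and `x` close to `x₀`, then two points on a common vertical have preimages
on the verticals of `x` and `x₀`, in this order. -/
lemma eventually_exists_vertical_pair (g : StripA ≃ₜ StripA)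
    (hgU : ∀ z, annProj (g z) ∈ U ↔ annProj z ∈ U)
    (hdown : ∀ {z p : StripA}, annProj z ∈ U → z.1 = p.1 → p.2 ≤ z.2 → annProj p ∈ U)
    {x₀ : ℝ} {c₀ c₁ c₂ : ↥(Icc (0:ℝ) 1)} (hc : c₀ ≤ c₂) (hm : annProj (x₀, c₁) ∉ U)
    (hs : ((g (x₀, c₀)).1 < (g (x₀, c₁)).1 ∧ (g (x₀, c₁)).1 < (g (x₀, c₂)).1) ∨
      ((g (x₀, c₂)).1 < (g (x₀, c₁)).1 ∧ (g (x₀, c₁)).1 < (g (x₀, c₀)).1)) :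
    ∀ᶠ x in 𝓝 x₀, annProj (x, c₂) ∈ U → ∃ z p : StripA, z.1 = p.1 ∧ (z.2 : ℝ) < p.2 ∧
      (g.symm z).1 = x ∧ (g.symm p).1 = x₀ := by
  have hcont : ∀ c, ContinuousAt (fun x : ℝ => (g (x, c)).1) x₀ := fun c =>
    (by fun_prop : Continuous fun x : ℝ => (g (x, c)).1).continuousAt
  have hev : ∀ᶠ x in 𝓝 x₀, (g (x₀, c₁)).1 ∈ uIcc (g (x, c₀)).1 (g (x, c₂)).1 := by
    rcases hs with ⟨h1, h2⟩ | ⟨h1, h2⟩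
    · filter_upwards [(hcont c₀).eventually_lt continuousAt_const h1,
        continuousAt_const.eventually_lt (hcont c₂) h2] with x h3 h4
      exact mem_uIcc.2 (.inl ⟨h3.le, h4.le⟩)
    · filter_upwards [(hcont c₂).eventually_lt continuousAt_const h1,
        continuousAt_const.eventually_lt (hcont c₀) h2] with x h3 h4
      exact mem_uIcc.2 (.inr ⟨h3.le, h4.le⟩)
  filter_upwards [hev] with x hx hxU
  have hproj : Continuous (projIcc (0:ℝ) 1 zero_le_one) := continuous_projIcc
  have hcy : Continuous fun y : ℝ => (g (x, projIcc (0:ℝ) 1 zero_le_one y)).1 := by fun_prop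
  obtain ⟨y, hy, hyX⟩ := intermediate_value_uIcc (a := (c₀ : ℝ)) (b := c₂) hcy.continuousOn
    (by simpa using hx)
  rw [uIcc_of_le (Subtype.coe_le_coe.2 hc)] at hy
  have hy2 : projIcc (0:ℝ) 1 zero_le_one y ≤ c₂ := by
    simpa using monotone_projIcc zero_le_one hy.2
  set y' := projIcc (0:ℝ) 1 zero_le_one y
  have hyU : annProj (g (x, y')) ∈ U := (hgU _).2 (hdown hxU rfl hy2)
  refine ⟨g (x, y'), g (x₀, c₁), hyX, ?_, by simp, by simp⟩
  by_contra! hcon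
  exact hm ((hgU _).1 (hdown hyU hyX hcon))

lemma PositiveTwistMap.eventually_notMem (f : PositiveTwistMap) (hUinv : f.toFun '' U = U)
    (hdown : ∀ {z p : StripA}, annProj z ∈ U → z.1 = p.1 → p.2 ≤ z.2 → annProj p ∈ U)
    {x₀ : ℝ} {c₀ c₁ c₂ : ↥(Icc (0:ℝ) 1)} (h01 : c₀ < c₁) (h12 : c₁ < c₂)
    (hm : annProj (x₀, c₁) ∉ U) : ∀ᶠ x in 𝓝 x₀, annProj (x, c₂) ∉ U := by
  have h1 := eventually_exists_vertical_pair f.lift (fun _ => f.lift_mem_iff hUinv) hdown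
    (h01.trans h12).le hm (.inl ⟨f.lift_fst_lt rfl h01, f.lift_fst_lt rfl h12⟩)
  have h2 := eventually_exists_vertical_pair f.lift.symm (fun _ => f.lift_symm_mem_iff hUinv) hdown
    (h01.trans h12).le hm (.inr ⟨f.lift_symm_fst_lt rfl h12, f.lift_symm_fst_lt rfl h01⟩)
  filter_upwards [h1, h2] with x h1 h2 hx
  obtain ⟨z, p, e1, e2, rfl, e3⟩ := h1 hx
  obtain ⟨z', p', e4, e5, e6, e7⟩ := h2 hx
  have h3 := f.lift_symm_fst_lt e1 e2
  have h4 := f.lift_fst_lt e4 e5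
  rw [Homeomorph.symm_symm] at e6 e7
  linarith

/-- An invariant lower annulus of a nonwandering twist map is a strict subgraph. -/
theorem PositiveTwistMap.exists_subgraph (f : PositiveTwistMap)
    (hnw : NonWandering f.toAnnulusHomeo) (hU : IsLowerAnnulus U) (hUinv : f.toFun '' U = U) :
    ∃ ψ : 𝕋 → ℝ, Continuous ψ ∧ (∀ x : 𝕋, ψ x ∈ Ioc (0:ℝ) 1) ∧
      U = {z : Ann | (z.2 : ℝ) < ψ z.1} := by
  have hdown : ∀ {z p : StripA}, annProj z ∈ U → z.1 = p.1 → p.2 ≤ z.2 → annProj p ∈ U :=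
    fun hz h1 h2 => f.mem_of_le hnw hU hUinv hz h1 h2
  have hdown' : ∀ {x : 𝕋} {y y' : ↥(Icc (0:ℝ) 1)}, (x, y) ∈ U → y' ≤ y → (x, y') ∈ U := by
    intro x y y' h hy
    obtain ⟨r, rfl⟩ := QuotientAddGroup.mk_surjective x
    exact hdown (z := (r, y)) (p := (r, y')) h rfl hy
  let V : 𝕋 → Set ℝ := fun x => (↑) '' {y : ↥(Icc (0:ℝ) 1) | (x, y) ∈ U}
  let ψ : 𝕋 → ℝ := fun x => sSup (V x)
  have hV1 : ∀ x, ∀ v ∈ V x, v ≤ 1 := by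
    rintro x _ ⟨y, -, rfl⟩
    exact y.2.2
  have hVb : ∀ x, BddAbove (V x) := fun x => ⟨1, hV1 x⟩
  have hVne : ∀ x, (V x).Nonempty := fun x => ⟨_, ⟨0, hU.2.2 rfl, rfl⟩⟩
  have hmem : ∀ x y, (x, y) ∈ U ↔ (y : ℝ) < ψ x := by
    intro x y
    constructor
    · intro h
      have hc : Continuous fun t : ℝ => ((x, projIcc (0:ℝ) 1 zero_le_one t) : Ann) := by
        have : Continuous (projIcc (0:ℝ) 1 zero_le_one) := continuous_projIcc
        fun_prop
      have hy1 : (y : ℝ) < 1 := by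
        refine lt_of_le_of_ne y.2.2 fun h1 => ?_
        obtain ⟨y', hy'⟩ := hU.exists_notMem_vertical x
        refine hy' (hdown' h (show (y' : ℝ) ≤ y from ?_))
        rw [h1]
        exact y'.2.2
      have hev : ∀ᶠ t in 𝓝 (y : ℝ), (x, projIcc (0:ℝ) 1 zero_le_one t) ∈ U :=
        (hU.1.preimage hc).mem_nhds (by simpa using h)
      obtain ⟨t, htU, ht1, ht2⟩ : ∃ t : ℝ, (x, projIcc (0:ℝ) 1 zero_le_one t) ∈ U ∧
          t ∈ Ioo (y : ℝ) 1 :=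
        ((hev.filter_mono nhdsWithin_le_nhds).and (Ioo_mem_nhdsGT hy1)).exists
      refine ht1.trans_le (le_csSup (hVb x) ⟨_, htU, ?_⟩)
      rw [projIcc_of_mem _ ⟨y.2.1.trans ht1.le, ht2.le⟩]
    · intro h
      obtain ⟨_, ⟨y', hy', rfl⟩, hlt⟩ := exists_lt_of_lt_csSup (hVne x) h
      exact hdown' hy' (show (y : ℝ) ≤ y' from hlt.le)
  have hψ0 : ∀ x, 0 < ψ x := fun x => (hmem x 0).1 (hU.2.2 rfl)
  have hψ1 : ∀ x, ψ x ≤ 1 := fun x => csSup_le (hVne x) (hV1 x)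
  refine ⟨ψ, ?_, fun x => ⟨hψ0 x, hψ1 x⟩, Set.ext fun z => hmem z.1 z.2⟩
  rw [continuous_iff_lower_upperSemicontinuous]
  constructor
  · intro x₀ c hc
    obtain ⟨_, ⟨y, hy, rfl⟩, hcy⟩ := exists_lt_of_lt_csSup (hVne x₀) hc
    have hc : Continuous fun x : 𝕋 => ((x, y) : Ann) := by fun_prop
    filter_upwards [(hU.1.preimage hc).mem_nhds hy] with x hx
    exact hcy.trans ((hmem x y).1 hx)
  · intro x₀ c hc
    obtain ⟨r, rfl⟩ := QuotientAddGroup.mk_surjective x₀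
    rcases (hψ1 (r : 𝕋)).eq_or_lt with h1 | h1
    · exact Eventually.of_forall fun x => (hψ1 x).trans_lt (h1 ▸ hc)
    obtain ⟨c₂, h2, h3⟩ := exists_between (lt_min hc h1)
    obtain ⟨c₁, h4, h5⟩ := exists_between h2
    have hpos := hψ0 (r : 𝕋)
    have hc2 : c₂ ∈ Icc (0:ℝ) 1 := ⟨(hpos.trans h2).le, (h3.trans_le (min_le_right _ _)).le⟩
    have hc1 : c₁ ∈ Icc (0:ℝ) 1 := ⟨(hpos.trans h4).le, h5.le.trans hc2.2⟩
    have hev := f.eventually_notMem hUinv hdown (x₀ := r) (c₀ := 0) (c₁ := ⟨c₁, hc1⟩)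
      (c₂ := ⟨c₂, hc2⟩) (Subtype.mk_lt_mk.2 (hpos.trans h4)) (Subtype.mk_lt_mk.2 h5)
      (fun h => h4.not_gt ((hmem _ _).1 h))
    have hmap : 𝓝 (r : 𝕋) = map (↑) (𝓝 r) :=
      ((AddCircle.isLocalHomeomorph_coe (1:ℝ)).map_nhds_eq r).symm
    change ∀ᶠ x in 𝓝 (r : 𝕋), ψ x < c
    rw [hmap, eventually_map]
    filter_upwards [hev] with x hx
    exact (not_lt.1 fun h => hx ((hmem _ _).2 h)).trans_lt (h3.trans_le (min_le_left _ _))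

end Subgraph

section Graph

/-- The identity of the circle is not null-homotopic. -/
lemma not_nullhomotopic_id_circle : ¬ (ContinuousMap.id 𝕋).Nullhomotopic := by
  rintro ⟨c, ⟨H⟩⟩
  obtain ⟨r, hr⟩ := QuotientAddGroup.mk_surjective c
  have cov : IsCoveringMap ((↑) : ℝ → 𝕋) := AddCircle.isCoveringMap_coe 1
  let L := cov.liftHomotopy H.symm.toContinuousMap (ContinuousMap.const 𝕋 r)
    (fun x => by simpa using hr.symm)
  have hL : ∀ x : 𝕋, ((L (1, x) : ℝ) : 𝕋) = x := by
    intro x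
    have := congr_fun (cov.liftHomotopy_lifts H.symm.toContinuousMap (ContinuousMap.const 𝕋 r)
      (fun x => by simpa using hr.symm)) (1, x)
    exact this.trans (H.symm.apply_one x)
  have hcoe := continuous_coe_circle
  have heq := cov.eq_of_comp_eq (g₁ := fun t : ℝ => L (1, (t : 𝕋)))
    (g₂ := fun t : ℝ => t + L (1, 0)) (by fun_prop) (by fun_prop)
    (by ext1 t; simp [hL]) 0 (by simp)
  have h1 := congr_fun heq 1
  simp only [AddCircle.coe_period] at h1
  linarith

variable {ψ : 𝕋 → ℝ} {U : Set Ann}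

lemma isRegularLowerAnnulus_of_subgraph (hψ : Continuous ψ) (hψ01 : ∀ x, ψ x ∈ Ioc (0:ℝ) 1)
    (hUψ : U = {z : Ann | (z.2 : ℝ) < ψ z.1}) (hU : IsPreconnected U) :
    IsRegularLowerAnnulus U := by
  let γ : C(𝕋, Ann) := ⟨fun x => (x, ⟨ψ x, (hψ01 x).1.le, (hψ01 x).2⟩), by fun_prop⟩
  have hrange : ∀ z, z ∈ range γ ↔ (z.2 : ℝ) = ψ z.1 := by
    intro z
    constructor
    · rintro ⟨x, rfl⟩
      rfl
    · intro h
      exact ⟨z.1, Prod.ext rfl (Subtype.ext h.symm)⟩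
  refine ⟨range γ, ⟨γ, fun x y h => congrArg Prod.fst h, fun h => ?_, rfl⟩, (0, 0), ?_⟩
  · exact not_nullhomotopic_id_circle (h.comp_right ContinuousMap.fst)
  have hUo : IsOpen U := hUψ ▸ isOpen_lt (by fun_prop) (by fun_prop)
  have hVo : IsOpen {z : Ann | ψ z.1 < z.2} := isOpen_lt (by fun_prop) (by fun_prop)
  have h0 : ((0, 0) : Ann) ∈ U := by
    rw [hUψ]
    exact (hψ01 0).1
  have hUc : U ⊆ (range γ)ᶜ := by
    intro z hz hz'
    rw [hUψ] at hz
    exact (ne_of_lt hz) ((hrange z).1 hz')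
  refine (hU.subset_connectedComponentIn h0 hUc).antisymm ?_
  refine isPreconnected_connectedComponentIn.subset_left_of_subset_union hUo hVo ?_ ?_
    ⟨_, mem_connectedComponentIn (hUc h0), h0⟩
  · rw [hUψ, Set.disjoint_left]
    exact fun z (h1 : (z.2 : ℝ) < ψ z.1) (h2 : ψ z.1 < z.2) => lt_asymm h1 h2
  · intro z hz
    have h1 := connectedComponentIn_subset _ _ hz
    rw [mem_compl_iff, hrange] at h1
    rw [hUψ]
    exact lt_or_gt_of_ne h1

lemma existsUnique_frontier_of_subgraph (hψ : Continuous ψ) (hψ01 : ∀ x, ψ x ∈ Ioc (0:ℝ) 1)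
    (hUψ : U = {z : Ann | (z.2 : ℝ) < ψ z.1}) (x : 𝕋) : ∃! z : Ann, z ∈ frontier U ∧ z.1 = x := by
  refine ⟨(x, ⟨ψ x, (hψ01 x).1.le, (hψ01 x).2⟩), ⟨?_, rfl⟩, ?_⟩
  · have hUo : IsOpen U := hUψ ▸ isOpen_lt (by fun_prop) (by fun_prop)
    rw [hUo.frontier_eq]
    refine ⟨?_, by rw [hUψ]; exact fun h => lt_irrefl (ψ x) h⟩
    have hproj : Continuous (projIcc (0:ℝ) 1 zero_le_one) := continuous_projIcc
    have hc : Continuous fun t : ℝ => ((x, projIcc (0:ℝ) 1 zero_le_one t) : Ann) := by fun_prop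
    have := map_mem_closure (s := Iio (ψ x)) (t := U) hc (x := ψ x) (by simp) (by
      intro t ht
      rw [hUψ]
      simp only [mem_ofPred_eq, coe_projIcc]
      exact max_lt (hψ01 x).1 ((min_le_right _ _).trans_lt ht))
    rwa [projIcc_of_mem _ ⟨(hψ01 x).1.le, (hψ01 x).2⟩] at this
  · rintro ⟨x', y⟩ ⟨hz, rfl⟩
    rw [hUψ] at hz
    have := frontier_lt_subset_eq (by fun_prop) (by fun_prop) hz
    exact Prod.ext rfl (Subtype.ext this)

end Graph

/-- An invariant lower annulus of a non wandering positive twist map is the strict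
subgraph of a continuous function `ψ : 𝕋 → (0,1]`; in particular it is regular and its
frontier meets each vertical segment in exactly one point. -/
theorem statement7 (f : PositiveTwistMap) (hnw : NonWandering f.toAnnulusHomeo)
    (U : Set Ann) (hU : IsLowerAnnulus U) (hUinv : f.toFun '' U = U) :
    (∃ ψ : 𝕋 → ℝ, Continuous ψ ∧ (∀ x : 𝕋, ψ x ∈ Set.Ioc (0:ℝ) 1) ∧
      U = {z : Ann | (z.2 : ℝ) < ψ z.1}) ∧
    IsRegularLowerAnnulus U ∧
    ∀ x : 𝕋, ∃! z : Ann, z ∈ frontier U ∧ z.1 = x := by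
  obtain ⟨ψ, hψ, hψ01, hUψ⟩ := f.exists_subgraph hnw hU hUinv
  exact ⟨⟨ψ, hψ, hψ01, hUψ⟩, isRegularLowerAnnulus_of_subgraph hψ hψ01 hUψ hU.isPreconnected,
    existsUnique_frontier_of_subgraph hψ hψ01 hUψ⟩
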